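/- Let α∈(0,1) and θ∈ℝ with α+θ>0, let (K_n,(K_{r,n})_{r≥1}) be the Ewens–Pitman block-counting chain with parameters (α,θ), and fix an integer d≥1. Then the random vector (√(K_n)(P_{1,n}−p_α(1)), …, √(K_n)(P_{d,n}−p_α(d))) converges in distribution, as n→∞, to a centered d-dimensional Gaussian distribution with covariance matrix Γ_d = J_d Λ_d J_d^T, where Λ_{i,j} = ((−1)^{i+j}(i+j)!/(i!j!))·p_α(i+j), and J_d is the lower-triangular d×d matrix with J_{i,j} = (j−α)^{(i−j)}/(i−j)! for 1≤j≤i and J_{i,j}=0 for j>i. -/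

import Mathlib

open MeasureTheory ProbabilityTheory Filter Topology

noncomputable section

/-- Rising factorial `(a)^(m) = a (a+1) ⋯ (a+m-1)` of a real number. -/
def risingFactorial (a : ℝ) : ℕ → ℝ
  | 0 => 1
  | m + 1 => risingFactorial a m * (a + m)

/-- Sibuya probabilities `p_α(r) = α (1-α)^(r-1) / r!` for `r ≥ 1`. -/
def sibuya (α : ℝ) (r : ℕ) : ℝ :=
  α * risingFactorial (1 - α) (r - 1) / (Nat.factorial r : ℝ)

/-- The Ewens–Pitman block-counting chain with parameters `(α, θ)` on a probability space
`(Ω, μ)` with filtration `F`: for `n ≥ 1`, `K n` is the number of blocks and `B r n` the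
number of blocks of size `r` of the Ewens–Pitman random partition of `{1,…,n}`.
It starts from `K 1 = 1`, `B 1 1 = 1`, `B r 1 = 0` for `r ≥ 2`, and the transition from
time `n` to `n+1` creates a new block with conditional probability `(α K n + θ)/(n + θ)`,
and grows a block of size `r` to size `r+1` with conditional probability
`(r - α) B r n / (n + θ)`. -/
structure IsEwensPitman (α θ : ℝ) {Ω : Type*} {mΩ : MeasurableSpace Ω}
    (μ : Measure Ω) (F : Filtration ℕ mΩ) (K : ℕ → Ω → ℕ) (B : ℕ → ℕ → Ω → ℕ) :
    Prop where
  prob : IsProbabilityMeasure μ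
  meas_K : ∀ n, Measurable[F n] (K n)
  meas_B : ∀ r n, Measurable[F n] (B r n)
  init_K : ∀ᵐ ω ∂μ, K 1 ω = 1
  init_B1 : ∀ᵐ ω ∂μ, B 1 1 ω = 1
  init_B : ∀ r, 2 ≤ r → ∀ᵐ ω ∂μ, B r 1 ω = 0
  B_eq_zero : ∀ r n, n < r → ∀ᵐ ω ∂μ, B r n ω = 0
  sum_blocks : ∀ n, 1 ≤ n → ∀ᵐ ω ∂μ, K n ω = ∑ r ∈ Finset.Icc 1 n, B r n ω
  sum_sizes : ∀ n, 1 ≤ n → ∀ᵐ ω ∂μ, n = ∑ r ∈ Finset.Icc 1 n, r * B r n ω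
  trans_new : ∀ n, 1 ≤ n →
    μ[Set.indicator {ω | K (n+1) ω = K n ω + 1 ∧ B 1 (n+1) ω = B 1 n ω + 1 ∧
        ∀ s, 2 ≤ s → B s (n+1) ω = B s n ω} (fun _ => (1:ℝ)) | F n]
      =ᵐ[μ] fun ω => (α * (K n ω : ℝ) + θ) / ((n : ℝ) + θ)
  trans_grow : ∀ n, 1 ≤ n → ∀ r, 1 ≤ r →
    μ[Set.indicator {ω | K (n+1) ω = K n ω ∧ B r (n+1) ω + 1 = B r n ω ∧
        B (r+1) (n+1) ω = B (r+1) n ω + 1 ∧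
        ∀ s, 1 ≤ s → s ≠ r → s ≠ r + 1 → B s (n+1) ω = B s n ω} (fun _ => (1:ℝ)) | F n]
      =ᵐ[μ] fun ω => (((r : ℝ) - α) * (B r n ω : ℝ)) / ((n : ℝ) + θ)

/-- Entry `Λ_{i,j} = (-1)^(i+j) (i+j)!/(i!j!) p_α(i+j)`. -/
def lambdaEntry (α : ℝ) (i j : ℕ) : ℝ :=
  (-1 : ℝ) ^ (i + j) * (Nat.factorial (i + j) : ℝ) /
    ((Nat.factorial i : ℝ) * (Nat.factorial j : ℝ)) * sibuya α (i + j)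

/-- Entry `J_{i,j} = (j-α)^(i-j)/(i-j)!` for `j ≤ i`, and `0` for `j > i`. -/
def jEntry (α : ℝ) (i j : ℕ) : ℝ :=
  if j ≤ i then risingFactorial ((j : ℝ) - α) (i - j) / (Nat.factorial (i - j) : ℝ) else 0

/-- Entry `(J_d Λ_d J_dᵀ)_{i,j} = ∑_{k=1}^i ∑_{ℓ=1}^j J_{i,k} Λ_{k,ℓ} J_{j,ℓ}`
(`1`-based indices). -/
def gammaEntry (α : ℝ) (i j : ℕ) : ℝ :=
  ∑ k ∈ Finset.Icc 1 i, ∑ l ∈ Finset.Icc 1 j,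
    jEntry α i k * lambdaEntry α k l * jEntry α j l


/-! ### Part 1: one-step transition -/

/-- New-block event. -/
def evNew {Ω : Type*} (K : ℕ → Ω → ℕ) (B : ℕ → ℕ → Ω → ℕ) (n : ℕ) : Set Ω :=
  {ω | K (n+1) ω = K n ω + 1 ∧ B 1 (n+1) ω = B 1 n ω + 1 ∧
        ∀ s, 2 ≤ s → B s (n+1) ω = B s n ω}

/-- Growth event. -/
def evGrow {Ω : Type*} (K : ℕ → Ω → ℕ) (B : ℕ → ℕ → Ω → ℕ) (n r : ℕ) : Set Ω :=
  {ω | K (n+1) ω = K n ω ∧ B r (n+1) ω + 1 = B r n ω ∧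
        B (r+1) (n+1) ω = B (r+1) n ω + 1 ∧
        ∀ s, 1 ≤ s → s ≠ r → s ≠ r + 1 → B s (n+1) ω = B s n ω}

section EP
variable {α θ : ℝ} {Ω : Type*} {mΩ : MeasurableSpace Ω}
    {μ : Measure Ω} {F : Filtration ℕ mΩ} {K : ℕ → Ω → ℕ} {B : ℕ → ℕ → Ω → ℕ}

lemma EP_measK (h : IsEwensPitman α θ μ F K B) (n : ℕ) : Measurable (K n) :=
  (h.meas_K n).mono (F.le n) le_rfl

lemma EP_measB (h : IsEwensPitman α θ μ F K B) (r n : ℕ) : Measurable (B r n) :=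
  (h.meas_B r n).mono (F.le n) le_rfl

lemma EP_measNew (h : IsEwensPitman α θ μ F K B) (n : ℕ) : MeasurableSet (evNew K B n) := by
  have hK := EP_measK h
  have hB := EP_measB h
  have e : evNew K B n = {ω | K (n+1) ω = K n ω + 1} ∩ ({ω | B 1 (n+1) ω = B 1 n ω + 1} ∩
      ⋂ s, ⋂ (_ : 2 ≤ s), {ω | B s (n+1) ω = B s n ω}) := by
    ext ω; simp [evNew]
  rw [e]
  refine (measurableSet_eq_fun (hK _) ((hK _).add_const 1)).inter
    ((measurableSet_eq_fun (hB _ _) ((hB _ _).add_const 1)).inter ?_)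
  exact MeasurableSet.iInter fun s => MeasurableSet.iInter fun _ =>
    measurableSet_eq_fun (hB _ _) (hB _ _)

lemma EP_measGrow (h : IsEwensPitman α θ μ F K B) (n r : ℕ) :
    MeasurableSet (evGrow K B n r) := by
  have hK := EP_measK h
  have hB := EP_measB h
  have e : evGrow K B n r = {ω | K (n+1) ω = K n ω} ∩ ({ω | B r (n+1) ω + 1 = B r n ω} ∩
      ({ω | B (r+1) (n+1) ω = B (r+1) n ω + 1} ∩
      ⋂ s, ⋂ (_ : 1 ≤ s), ⋂ (_ : s ≠ r), ⋂ (_ : s ≠ r+1), {ω | B s (n+1) ω = B s n ω})) := by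
    ext ω; simp [evGrow]
  rw [e]
  refine (measurableSet_eq_fun (hK _) (hK _)).inter
    ((measurableSet_eq_fun ((hB _ _).add_const 1) (hB _ _)).inter
    ((measurableSet_eq_fun (hB _ _) ((hB _ _).add_const 1)).inter ?_))
  exact MeasurableSet.iInter fun s => MeasurableSet.iInter fun _ => MeasurableSet.iInter fun _ =>
    MeasurableSet.iInter fun _ => measurableSet_eq_fun (hB _ _) (hB _ _)

lemma ev_disj1 (n r : ℕ) : Disjoint (evNew K B n) (evGrow K B n r) := by
  rw [Set.disjoint_left]
  rintro ω ⟨h1, -⟩ ⟨h2, -⟩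
  omega

lemma ev_disj2 (n r s : ℕ) (hr : 1 ≤ r) (_hs : 1 ≤ s) (hrs : r ≠ s) :
    Disjoint (evGrow K B n r) (evGrow K B n s) := by
  rw [Set.disjoint_left]
  rintro ω ⟨-, h1, h2, h3⟩ ⟨-, h4, h5, h6⟩
  by_cases e : r = s + 1
  · subst e; omega
  · have := h6 r hr hrs e
    omega

/-- Basic a.s. bounds. -/
lemma EP_basic (h : IsEwensPitman α θ μ F K B) (n : ℕ) (hn : 1 ≤ n) :
    ∀ᵐ ω ∂μ, 1 ≤ K n ω ∧ K n ω ≤ n ∧ ∀ r, 1 ≤ r → B r n ω ≤ K n ω := by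
  have h0 : ∀ᵐ ω ∂μ, ∀ r, n < r → B r n ω = 0 := by
    rw [ae_all_iff]; intro r
    by_cases hr : n < r
    · filter_upwards [h.B_eq_zero r n hr] with ω hω _ using hω
    · filter_upwards with ω hω using absurd hω hr
  filter_upwards [h0, h.sum_blocks n hn, h.sum_sizes n hn] with ω h0 h1 h2
  refine ⟨?_, ?_, ?_⟩
  · by_contra hc
    have hk : K n ω = 0 := by omega
    rw [hk] at h1
    have h3 : ∀ r ∈ Finset.Icc 1 n, B r n ω = 0 := Finset.sum_eq_zero_iff.1 h1.symm
    rw [Finset.sum_eq_zero (fun r hr => by rw [h3 r hr, mul_zero])] at h2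
    omega
  · rw [h1]
    calc _ ≤ ∑ r ∈ Finset.Icc 1 n, r * B r n ω := by
          refine Finset.sum_le_sum fun r hr => ?_
          have := (Finset.mem_Icc.1 hr).1
          nlinarith
      _ = n := h2.symm
  · intro r hr
    by_cases hrn : n < r
    · rw [h0 r hrn]; omega
    · rw [h1]
      exact Finset.single_le_sum (f := fun r => B r n ω) (fun i _ => Nat.zero_le _)
        (Finset.mem_Icc.2 ⟨hr, by omega⟩)

lemma EP_smul {E : Type*} [NormedAddCommGroup E] [NormedSpace ℝ E] [CompleteSpace E]
    [IsProbabilityMeasure μ]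
    (n : ℕ) (A : Set Ω) (hA : MeasurableSet A) (P : Ω → ℝ)
    (hP : μ[Set.indicator A (fun _ => (1:ℝ)) | F n] =ᵐ[μ] P)
    (D : Ω → E) (hD : StronglyMeasurable[F n] D) (hDi : Integrable D μ) :
    Integrable (fun ω => A.indicator (fun _ => (1:ℝ)) ω • D ω) μ ∧
    Integrable (fun ω => P ω • D ω) μ ∧
    ∫ ω, A.indicator (fun _ => (1:ℝ)) ω • D ω ∂μ = ∫ ω, P ω • D ω ∂μ := by
  have i1 : Integrable (A.indicator (fun _ => (1:ℝ))) μ := (integrable_const 1).indicator hA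
  have i2 : Integrable ((A.indicator (fun _ => (1:ℝ))) • D) μ := by
    have : (A.indicator (fun _ => (1:ℝ))) • D = A.indicator D := by
      ext ω; by_cases hω : ω ∈ A <;> simp [hω]
    rw [this]; exact hDi.indicator hA
  have key := condExp_smul_of_aestronglyMeasurable_right (μ := μ) (m := F n)
    i1 i2 hD.aestronglyMeasurable
  have e : (fun ω => P ω • D ω) =ᵐ[μ]
      μ[(A.indicator (fun _ => (1:ℝ))) • D | F n] := by
    filter_upwards [key, hP] with ω h1 h2
    rw [h1]; simp [h2]
  refine ⟨i2, integrable_condExp.congr e.symm, ?_⟩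
  rw [integral_congr_ae e, integral_condExp (F.le n)]
  rfl

/-- A.s. one of the transitions occurs. -/
lemma EP_exhaust (h : IsEwensPitman α θ μ F K B) (hα1 : α < 1)
    (hθ : 0 < α + θ) (n : ℕ) (hn : 1 ≤ n) :
    ∀ᵐ ω ∂μ, ω ∈ evNew K B n ∨ ∃ r, 1 ≤ r ∧ ω ∈ evGrow K B n r := by
  have := h.prob
  have hpos : 0 < (n:ℝ) + θ := by
    have : (1:ℝ) ≤ n := by exact_mod_cast hn
    linarith
  have c0 := EP_smul n _ (EP_measNew h n) _ (h.trans_new n hn) (fun _ => (1:ℝ))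
    stronglyMeasurable_const (integrable_const 1)
  have cr := fun r (hr : 1 ≤ r) => EP_smul n _ (EP_measGrow h n r) _ (h.trans_grow n hn r hr)
    (fun _ => (1:ℝ)) stronglyMeasurable_const (integrable_const 1)
  simp only [smul_eq_mul, mul_one] at c0 cr
  rw [integral_indicator_const _ (EP_measNew h n)] at c0
  have cr' : ∀ r, 1 ≤ r → μ.real (evGrow K B n r) =
      ∫ ω, ((r : ℝ) - α) * (B r n ω : ℝ) / ((n : ℝ) + θ) ∂μ := by
    intro r hr
    rw [← (cr r hr).2.2, integral_indicator_const _ (EP_measGrow h n r)]; simp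
  set U : Set Ω := evNew K B n ∪ ⋃ r ∈ Finset.Icc 1 n, evGrow K B n r with hU
  have hUm : MeasurableSet U := (EP_measNew h n).union
    (Finset.measurableSet_biUnion _ fun r _ => EP_measGrow h n r)
  have hUr : μ.real U = 1 := by
    rw [hU, measureReal_union _ (Finset.measurableSet_biUnion _ fun r _ => EP_measGrow h n r)
      (measure_ne_top _ _) (measure_ne_top _ _),
      measureReal_biUnion_finset]
    · rw [Finset.sum_congr rfl (fun r hr => cr' r (Finset.mem_Icc.1 hr).1)]
      have e0 := c0.2.2
      simp only [smul_eq_mul, mul_one] at e0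
      rw [e0, ← integral_finsetSum, ← integral_add]
      · have : (fun ω => (α * (K n ω : ℝ) + θ) / ((n : ℝ) + θ) +
          ∑ r ∈ Finset.Icc 1 n, ((r : ℝ) - α) * (B r n ω : ℝ) / ((n : ℝ) + θ)) =ᵐ[μ]
            fun _ => 1 := by
          filter_upwards [h.sum_blocks n hn, h.sum_sizes n hn] with ω h1 h2
          rw [← Finset.sum_div, ← add_div, div_eq_one_iff_eq hpos.ne']
          have h1' : (K n ω : ℝ) = ∑ r ∈ Finset.Icc 1 n, (B r n ω : ℝ) := by
            rw [h1]; push_cast; rfl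
          have h2' : (n : ℝ) = ∑ r ∈ Finset.Icc 1 n, (r:ℝ) * (B r n ω : ℝ) := by
            conv_lhs => rw [h2]
            push_cast; rfl
          have : ∑ r ∈ Finset.Icc 1 n, ((r : ℝ) - α) * (B r n ω : ℝ) = n - α * K n ω := by
            rw [h1', h2', Finset.mul_sum, ← Finset.sum_sub_distrib]
            exact Finset.sum_congr rfl fun r _ => by ring
          rw [this]; ring
        rw [integral_congr_ae this]; simp
      · exact c0.2.1
      · exact integrable_finsetSum _ fun r hr => (cr r (Finset.mem_Icc.1 hr).1).2.1
      · exact fun r hr => (cr r (Finset.mem_Icc.1 hr).1).2.1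
    · intro r hr s hs hrs
      exact ev_disj2 n r s (Finset.mem_Icc.1 hr).1 (Finset.mem_Icc.1 hs).1 hrs
    · exact fun r _ => EP_measGrow h n r
    · rw [Set.disjoint_iUnion₂_right]
      exact fun r _ => ev_disj1 n r
  have hae : ∀ᵐ ω ∂μ, ω ∈ U := by
    have : μ U = 1 := by
      rw [measureReal_def] at hUr
      exact (ENNReal.toReal_eq_one_iff _).1 hUr
    exact (mem_ae_iff_prob_eq_one hUm).2 this
  filter_upwards [hae] with ω hω
  rcases hω with hω | hω
  · exact Or.inl hω
  · simp only [Set.mem_iUnion, Finset.mem_Icc] at hω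
    obtain ⟨r, hr, hω⟩ := hω
    exact Or.inr ⟨r, hr.1, hω⟩
end EP

/-- Linear statistic `∑ h r (B r - p r K)`. -/
def XX (α : ℝ) {Ω : Type*} (K : ℕ → Ω → ℕ) (B : ℕ → ℕ → Ω → ℕ) (d : ℕ) (h : ℕ → ℝ)
    (n : ℕ) (ω : Ω) : ℝ :=
  ∑ r ∈ Finset.Icc 1 d, h r * ((B r n ω : ℝ) - sibuya α r * (K n ω : ℝ))

/-- `h 1 - ∑ h r p r`. -/
def ff1 (α : ℝ) (d : ℕ) (h : ℕ → ℝ) : ℝ := h 1 - ∑ r ∈ Finset.Icc 1 d, h r * sibuya α r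

section EP
variable {α θ : ℝ} {Ω : Type*} {mΩ : MeasurableSpace Ω}
    {μ : Measure Ω} {F : Filtration ℕ mΩ} {K : ℕ → Ω → ℕ} {B : ℕ → ℕ → Ω → ℕ}

lemma phi_int {E : Type*} [NormedAddCommGroup E] [NormedSpace ℝ E]
    [IsProbabilityMeasure μ] {m : MeasurableSpace Ω} (hm : m ≤ mΩ)
    (φ : ℕ → ℝ → E) (hφ : ∀ k, Continuous (φ k))
    (κ : Ω → ℕ) (hκ : Measurable[m] κ) (Y : Ω → ℝ) (hY : Measurable[m] Y) (M : ℕ) (R : ℝ)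
    (hκM : ∀ᵐ ω ∂μ, κ ω ≤ M) (hYR : ∀ᵐ ω ∂μ, |Y ω| ≤ R) :
    StronglyMeasurable[m] (fun ω => φ (κ ω) (Y ω)) ∧ Integrable (fun ω => φ (κ ω) (Y ω)) μ := by
  have hc : Continuous (fun p : ℕ × ℝ => φ p.1 p.2) := continuous_prod_of_discrete_left.2 hφ
  have hs : StronglyMeasurable[m] (fun ω => φ (κ ω) (Y ω)) :=
    hc.comp_stronglyMeasurable (hκ.stronglyMeasurable.prodMk hY.stronglyMeasurable)
  refine ⟨hs, ?_⟩
  have hcomp : IsCompact ((Set.Iic M) ×ˢ (Metric.closedBall (0:ℝ) R)) :=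
    (Set.finite_Iic M).isCompact.prod (isCompact_closedBall _ _)
  obtain ⟨C, hC⟩ := hcomp.exists_bound_of_continuousOn hc.continuousOn
  refine Integrable.of_bound (hs.mono hm).aestronglyMeasurable C ?_
  filter_upwards [hκM, hYR] with ω h1 h2
  exact hC (κ ω, Y ω) ⟨h1, by simpa using h2⟩

lemma XX_meas (hEP : IsEwensPitman α θ μ F K B) (d : ℕ) (h : ℕ → ℝ) (n : ℕ) :
    Measurable[F n] (XX α K B d h n) := by
  unfold XX
  have hK := hEP.meas_K n
  refine Finset.measurable_fun_sum _ fun r _ => ?_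
  have hB := hEP.meas_B r n
  refine Measurable.const_mul (Measurable.sub ?_ (Measurable.const_mul ?_ _)) _
  · exact (Measurable.of_discrete (f := fun k : ℕ => (k:ℝ))).comp hB
  · exact (Measurable.of_discrete (f := fun k : ℕ => (k:ℝ))).comp hK

lemma XX_bound (d : ℕ) (h : ℕ → ℝ) (n : ℕ) (ω : Ω)
    (hB : ∀ r, 1 ≤ r → B r n ω ≤ K n ω) :
    |XX α K B d h n ω| ≤ (∑ r ∈ Finset.Icc 1 d, |h r| * (1 + |sibuya α r|)) * K n ω := by
  unfold XX
  refine (Finset.abs_sum_le_sum_abs _ _).trans ?_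
  rw [Finset.sum_mul]
  refine Finset.sum_le_sum fun r hr => ?_
  rw [abs_mul, mul_assoc]
  refine mul_le_mul_of_nonneg_left ?_ (abs_nonneg _)
  have h1 : (B r n ω : ℝ) ≤ K n ω := by exact_mod_cast hB r (Finset.mem_Icc.1 hr).1
  calc _ ≤ |(B r n ω : ℝ)| + |sibuya α r * (K n ω : ℝ)| := abs_sub _ _
    _ ≤ (1 + |sibuya α r|) * K n ω := by
      rw [abs_mul, Nat.abs_cast, Nat.abs_cast]; linarith

lemma XX_new (d : ℕ) (hd : 1 ≤ d) (h : ℕ → ℝ) (n : ℕ) (ω : Ω) (hω : ω ∈ evNew K B n) :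
    XX α K B d h (n+1) ω = XX α K B d h n ω + ff1 α d h := by
  obtain ⟨h1, h2, h3⟩ := hω
  unfold XX ff1
  have e : ∀ r ∈ Finset.Icc 1 d, h r * ((B r (n+1) ω : ℝ) - sibuya α r * (K (n+1) ω : ℝ)) =
      h r * ((B r n ω : ℝ) - sibuya α r * (K n ω : ℝ)) + ((if r = 1 then h 1 else 0)
        - h r * sibuya α r) := by
    intro r hr
    have := (Finset.mem_Icc.1 hr).1
    rw [h1]
    by_cases hr1 : r = 1
    · subst hr1; rw [h2, if_pos rfl]; push_cast; ring
    · rw [h3 r (by omega)]; push_cast; simp [hr1]; ring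
  rw [Finset.sum_congr rfl e, Finset.sum_add_distrib, Finset.sum_sub_distrib,
    Finset.sum_ite_eq' (Finset.Icc 1 d) 1 (fun _ => h 1), if_pos (by simp [hd])]

lemma XX_grow (d : ℕ) (h : ℕ → ℝ) (hh : h (d+1) = 0) (n r : ℕ) (hr : 1 ≤ r) (ω : Ω)
    (hω : ω ∈ evGrow K B n r) :
    XX α K B d h (n+1) ω = XX α K B d h n ω + if r ≤ d then (h (r+1) - h r) else 0 := by
  obtain ⟨h1, h2, h3, h4⟩ := hω
  unfold XX
  have e : ∀ s ∈ Finset.Icc 1 d, h s * ((B s (n+1) ω : ℝ) - sibuya α s * (K (n+1) ω : ℝ)) =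
      h s * ((B s n ω : ℝ) - sibuya α s * (K n ω : ℝ)) + ((if s = r + 1 then h (r+1) else 0)
        - (if s = r then h r else 0)) := by
    intro s hs
    have := (Finset.mem_Icc.1 hs).1
    rw [h1]
    by_cases hs1 : s = r
    · subst hs1; rw [← h2]; push_cast; simp; ring
    · by_cases hs2 : s = r + 1
      · subst hs2; rw [h3]; push_cast; simp; ring
      · rw [h4 s this hs1 hs2]; simp [hs1, hs2]
  rw [Finset.sum_congr rfl e, Finset.sum_add_distrib, Finset.sum_sub_distrib,
    Finset.sum_ite_eq' (Finset.Icc 1 d) r (fun _ => h r),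
    Finset.sum_ite_eq' (Finset.Icc 1 d) (r+1) (fun _ => h (r+1))]
  congr 1
  simp only [Finset.mem_Icc]
  by_cases hrd : r ≤ d
  · by_cases hrd' : r + 1 ≤ d
    · simp [hr, hrd, hrd']
    · have : r = d := by omega
      subst this
      simp [hr, hh]
  · simp [hrd, show ¬ (r + 1 ≤ d) by omega]

/-- One-step generator applied to `φ`. -/
def genE (α θ : ℝ) {E : Type*} [NormedAddCommGroup E] [NormedSpace ℝ E]
    (φ : ℕ → ℝ → E) (d : ℕ) (h : ℕ → ℝ) (k : ℕ) (b : ℕ → ℕ) (x : ℝ) : E :=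
  (α * (k:ℝ) + θ) • (φ (k+1) (x + ff1 α d h) - φ k x) +
    ∑ r ∈ Finset.Icc 1 d, (((r:ℝ) - α) * (b r : ℝ)) • (φ k (x + (h (r+1) - h r)) - φ k x)

lemma EP_step {E : Type*} [NormedAddCommGroup E] [NormedSpace ℝ E] [CompleteSpace E]
    (hEP : IsEwensPitman α θ μ F K B) (hα1 : α < 1) (hθ : 0 < α + θ)
    (φ : ℕ → ℝ → E) (hφ : ∀ k, Continuous (φ k)) (d : ℕ) (hd : 1 ≤ d) (h : ℕ → ℝ)
    (hh : h (d+1) = 0) (n : ℕ) (hn : 1 ≤ n) :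
    Integrable (fun ω => φ (K n ω) (XX α K B d h n ω)) μ ∧
    Integrable (fun ω => ((n:ℝ) + θ)⁻¹ •
      genE α θ φ d h (K n ω) (fun r => B r n ω) (XX α K B d h n ω)) μ ∧
    ∫ ω, φ (K (n+1) ω) (XX α K B d h (n+1) ω) ∂μ =
      ∫ ω, φ (K n ω) (XX α K B d h n ω) ∂μ + ∫ ω, ((n:ℝ) + θ)⁻¹ •
        genE α θ φ d h (K n ω) (fun r => B r n ω) (XX α K B d h n ω) ∂μ := by
  have := hEP.prob
  set R := (∑ r ∈ Finset.Icc 1 d, |h r| * (1 + |sibuya α r|)) * n with hR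
  have hXR : ∀ᵐ ω ∂μ, |XX α K B d h n ω| ≤ R := by
    filter_upwards [EP_basic hEP n hn] with ω hω
    refine (XX_bound d h n ω hω.2.2).trans ?_
    have : (K n ω : ℝ) ≤ n := by exact_mod_cast hω.2.1
    exact mul_le_mul_of_nonneg_left this (Finset.sum_nonneg fun r _ => by positivity)
  have hKn : ∀ᵐ ω ∂μ, K n ω ≤ n := (EP_basic hEP n hn).mono fun ω hω => hω.2.1
  have hXm := XX_meas (α := α) hEP d h n
  have base := phi_int (μ := μ) (F.le n) φ hφ _ (hEP.meas_K n) _ hXm n R hKn hXR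
  have shift : ∀ c, StronglyMeasurable[F n] (fun ω => φ (K n ω) (XX α K B d h n ω + c)) ∧
      Integrable (fun ω => φ (K n ω) (XX α K B d h n ω + c)) μ := by
    intro c
    refine phi_int (μ := μ) (F.le n) φ hφ _ (hEP.meas_K n) _ (hXm.add_const c) n (R + |c|) hKn ?_
    filter_upwards [hXR] with ω hω
    exact (abs_add_le _ _).trans (by gcongr)
  have new : StronglyMeasurable[F n] (fun ω => φ (K n ω + 1) (XX α K B d h n ω + ff1 α d h)) ∧
      Integrable (fun ω => φ (K n ω + 1) (XX α K B d h n ω + ff1 α d h)) μ := by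
    refine phi_int (μ := μ) (F.le n) (fun k => φ (k+1)) (fun k => hφ (k+1)) _ (hEP.meas_K n) _
      (hXm.add_const _) n (R + |ff1 α d h|) hKn ?_
    filter_upwards [hXR] with ω hω
    exact (abs_add_le _ _).trans (by gcongr)
  have c0 := EP_smul n _ (EP_measNew hEP n) _ (hEP.trans_new n hn) _ (new.1.sub base.1)
    (new.2.sub base.2)
  have cr := fun r (hr : 1 ≤ r) => EP_smul n _ (EP_measGrow hEP n r) _ (hEP.trans_grow n hn r hr)
    _ ((shift (h (r+1) - h r)).1.sub base.1) ((shift (h (r+1) - h r)).2.sub base.2)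
  simp only [Pi.sub_apply] at c0 cr
  have esplit : ∀ ω, ((n:ℝ) + θ)⁻¹ •
      genE α θ φ d h (K n ω) (fun r => B r n ω) (XX α K B d h n ω) =
      ((α * (K n ω : ℝ) + θ) / ((n : ℝ) + θ)) •
        (φ (K n ω + 1) (XX α K B d h n ω + ff1 α d h) - φ (K n ω) (XX α K B d h n ω)) +
      ∑ r ∈ Finset.Icc 1 d, ((((r : ℝ) - α) * (B r n ω : ℝ)) / ((n : ℝ) + θ)) •
        (φ (K n ω) (XX α K B d h n ω + (h (r+1) - h r)) - φ (K n ω) (XX α K B d h n ω)) := by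
    intro ω
    rw [genE, smul_add, Finset.smul_sum, smul_smul]
    simp only [smul_smul, div_eq_inv_mul]
  have hsumint := integrable_finsetSum (μ := μ) (Finset.Icc 1 d)
    fun r hr => (cr r (Finset.mem_Icc.1 hr).1).2.1
  have hsumint' := integrable_finsetSum (μ := μ) (Finset.Icc 1 d)
    fun r hr => (cr r (Finset.mem_Icc.1 hr).1).1
  refine ⟨base.2, ?_, ?_⟩
  · simp_rw [esplit]
    exact c0.2.1.add hsumint
  · simp_rw [esplit]
    have e1 := integral_add c0.2.1 hsumint
    rw [e1, integral_finsetSum _ fun r hr => (cr r (Finset.mem_Icc.1 hr).1).2.1]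
    have e2 := c0.2.2
    rw [← e2]
    have e3 : ∀ r ∈ Finset.Icc 1 d, _ := fun r hr => (cr r (Finset.mem_Icc.1 hr).1).2.2
    rw [← Finset.sum_congr rfl e3]
    have i3 : ∀ r ∈ Finset.Icc 1 d, _ := fun r hr => (cr r (Finset.mem_Icc.1 hr).1).1
    rw [← integral_finsetSum _ i3, ← integral_add c0.1 hsumint']
    have e4 := integral_add base.2 (c0.1.add hsumint')
    simp only [Pi.add_apply] at e4
    rw [← e4]
    refine integral_congr_ae ?_
    filter_upwards [EP_exhaust hEP hα1 hθ n hn] with ω hω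
    rcases hω with hω | ⟨r, hr, hω⟩
    · have hno : ∀ r, ω ∉ evGrow K B n r := fun r hr => (Set.disjoint_left.1 (ev_disj1 n r)) hω hr
      simp only [hno, Set.indicator_of_mem hω, Set.indicator_of_notMem, not_false_eq_true,
        zero_smul, Finset.sum_const_zero, one_smul, add_zero]
      rw [XX_new d hd h n ω hω, hω.1]
      abel
    · have hno : ω ∉ evNew K B n := fun hr => (Set.disjoint_left.1 (ev_disj1 n r)) hr hω
      have hs : ∀ s ∈ Finset.Icc 1 d, (evGrow K B n s).indicator (fun _ => (1:ℝ)) ω •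
          (φ (K n ω) (XX α K B d h n ω + (h (s+1) - h s)) - φ (K n ω) (XX α K B d h n ω)) =
          if s = r then (φ (K n ω) (XX α K B d h n ω + (h (r+1) - h r)) -
            φ (K n ω) (XX α K B d h n ω)) else 0 := by
        intro s hs
        by_cases e : s = r
        · subst e; simp [hω]
        · have : ω ∉ evGrow K B n s := fun h' =>
            (Set.disjoint_left.1 (ev_disj2 n s r (Finset.mem_Icc.1 hs).1 hr e)) h' hω
          simp [this, e]
      rw [Finset.sum_congr rfl hs, Set.indicator_of_notMem hno, zero_smul, zero_add,
        Finset.sum_ite_eq' (Finset.Icc 1 d) r, XX_grow d h hh n r hr ω hω, hω.1]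
      by_cases hrd : r ≤ d
      · simp [hr, hrd]
      · simp [hrd]
end EP

/-! ### Part 3: summability estimates -/

lemma summable_aux (v w t : ℕ → ℝ) (c : ℝ) (hc : 0 < c) (hv : ∀ n, 0 ≤ v n) (ht : ∀ n, 0 ≤ t n)
    (hw0 : ∀ n, 0 ≤ w n) (hw : Summable (fun n => w n * t n))
    (h : ∀ n, v (n+1) ≤ v n + t n * (- c * v n + w n)) :
    Summable (fun n => v n * t n) := by
  refine summable_of_sum_range_le (c := (v 0 + ∑' n, w n * t n) / c)
    (fun n => mul_nonneg (hv n) (ht n)) ?_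
  intro N
  have key : ∀ N, v N + c * ∑ i ∈ Finset.range N, v i * t i ≤
      v 0 + ∑ i ∈ Finset.range N, w i * t i := by
    intro N
    induction N with
    | zero => simp
    | succ N ih =>
      rw [Finset.sum_range_succ, Finset.sum_range_succ]
      have := h N
      nlinarith
  rw [le_div_iff₀ hc]
  have h1 := key N
  have h2 := hw.sum_le_tsum (Finset.range N) (fun i _ => mul_nonneg (hw0 i) (ht i))
  have := hv N
  linarith

lemma sibuya_one (α : ℝ) : sibuya α 1 = α := by simp [sibuya, risingFactorial]

lemma sibuya_succ (α : ℝ) (r : ℕ) (hr : 1 ≤ r) :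
    ((r:ℝ) + 1) * sibuya α (r+1) = ((r:ℝ) - α) * sibuya α r := by
  obtain ⟨q, rfl⟩ : ∃ q, r = q + 1 := ⟨r - 1, by omega⟩
  simp only [sibuya, Nat.add_sub_cancel, risingFactorial, Nat.factorial_succ]
  have : (q.factorial : ℝ) ≠ 0 := by positivity
  push_cast
  field_simp
  ring

lemma sibuya_pos (α : ℝ) (h0 : 0 < α) (h1 : α < 1) (r : ℕ) (hr : 1 ≤ r) : 0 < sibuya α r := by
  induction r, hr using Nat.le_induction with
  | base => rwa [sibuya_one]
  | succ r hr ih =>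
    have h := sibuya_succ α r hr
    have hr' : (1:ℝ) ≤ r := by exact_mod_cast hr
    have : 0 < ((r:ℝ) - α) * sibuya α r := mul_pos (by linarith) ih
    rw [← h] at this
    exact (mul_pos_iff_of_pos_left (by positivity)).1 this

lemma aK_lower (α θ : ℝ) (k : ℝ) (hk : 1 ≤ k) (_hα0 : 0 < α) :
    min α (α + θ) * k ≤ α * k + θ := by
  rcases min_cases α (α+θ) with ⟨h, h'⟩ | ⟨h, h'⟩ <;> rw [h] <;> nlinarith

lemma inv_sqrt_drift (α θ : ℝ) (k : ℝ) (hk : 1 ≤ k) (hα0 : 0 < α) (hθ : 0 < α + θ) :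
    (α * k + θ) * (1 / √(k+1) - 1 / √k) ≤ - (min α (α+θ) / 4) * (1 / √k) := by
  have hm : 0 < min α (α+θ) := lt_min hα0 hθ
  have h1 := aK_lower α θ k hk hα0
  set c := min α (α+θ)
  have hs : 0 < √k := Real.sqrt_pos.2 (by linarith)
  have ht : 0 < √(k+1) := Real.sqrt_pos.2 (by linarith)
  have hs2 : √k ^ 2 = k := Real.sq_sqrt (by linarith)
  have ht2 : √(k+1) ^ 2 = k + 1 := Real.sq_sqrt (by linarith)
  have hst : √k ≤ √(k+1) := Real.sqrt_le_sqrt (by linarith)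
  have hd : 1 / √(k+1) - 1 / √k ≤ - (1 / (4 * k)) * (1 / √k) := by
    have : 1 / √(k+1) - 1/√k = - (1 / (√(k+1) * (√k + √(k+1)))) * (1/√k) := by
      field_simp
      nlinarith
    rw [this]
    refine mul_le_mul_of_nonneg_right ?_ (by positivity)
    rw [neg_le_neg_iff]
    apply one_div_le_one_div_of_le (by positivity)
    nlinarith
  calc _ ≤ (α * k + θ) * (- (1 / (4 * k)) * (1 / √k)) :=
        mul_le_mul_of_nonneg_left hd (by nlinarith)
    _ = - ((α * k + θ) / (4 * k)) * (1/√k) := by ring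
    _ ≤ _ := by
      refine mul_le_mul_of_nonneg_right ?_ (by positivity)
      rw [neg_le_neg_iff, div_le_div_iff₀ (by norm_num) (by linarith)]
      nlinarith

lemma aux_mul_le (a r b k : ℝ) (ha : 0 ≤ a) (har : a ≤ r) (hb : b ≤ k) (hk : 0 ≤ k) :
    a * b ≤ r * k :=
  (mul_le_mul_of_nonneg_left hb ha).trans (mul_le_mul_of_nonneg_right har hk)

lemma quad_core (α θ r p p1 k b b1 : ℝ) (hα0 : 0 < α) (hα1 : α < 1) (hk : 1 ≤ k)
    (hr : 2 ≤ r) (hb : b ≤ k) (hb0 : 0 ≤ b) (hb1 : b1 ≤ k)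
    (hp : r * p = (r - 1 - α) * p1) :
    (α * k + θ) * ((b - p * k - p)^2 - (b - p * k)^2) +
    ((r - 1 - α) * b1 * ((b - p * k + 1)^2 - (b - p * k)^2) +
     (r - α) * b * ((b - p * k - 1)^2 - (b - p * k)^2)) ≤
    (- (1-α)) * ((b - p * k)^2) + r * ((b1 - p1 * k)^2) +
      (2 * |θ| * |p| * (1 + |p|) + (α + |θ|) * p^2 + 2 * r) * k := by
  set x := b - p * k with hx
  set y := b1 - p1 * k with hy
  have hbx : b = x + p * k := by rw [hx]; ring
  have hby : b1 = y + p1 * k := by rw [hy]; ring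
  have hxk : |x| ≤ (1 + |p|) * k := by
    rw [hx]
    calc |b - p * k| ≤ |b| + |p * k| := abs_sub _ _
      _ = b + |p| * k := by rw [abs_of_nonneg hb0, abs_mul, abs_of_pos (by linarith : 0 < k)]
      _ ≤ _ := by linarith
  have lin : (α * k + θ) * (-2 * x * p) + ((r-1-α) * b1 * (2 * x) + (r - α) * b * (-2*x)) =
      -2 * θ * p * x + 2 * (r-1-α) * x * y - 2 * (r - α) * x^2 := by
    rw [hbx, hby]
    linear_combination (-2 * x * k) * hp
  have t1 : -2 * θ * p * x ≤ 2 * |θ| * |p| * (1 + |p|) * k := by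
    calc -2 * θ * p * x ≤ |-2 * θ * p * x| := le_abs_self _
      _ = 2 * |θ| * |p| * |x| := by rw [abs_mul, abs_mul, abs_mul]; norm_num
      _ ≤ 2 * |θ| * |p| * ((1 + |p|) * k) := by gcongr
      _ = _ := by ring
  have t2 : 2 * (r-1-α) * x * y ≤ (r-1-α) * (x^2 + y^2) := by
    nlinarith [mul_nonneg (by linarith : 0 ≤ r - 1 - α) (sq_nonneg (x - y))]
  have t3 : (α * k + θ) * p^2 ≤ (α + |θ|) * p^2 * k := by
    have : α * k + θ ≤ (α + |θ|) * k := by nlinarith [le_abs_self θ, abs_nonneg θ]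
    calc _ ≤ (α + |θ|) * k * p^2 := mul_le_mul_of_nonneg_right this (sq_nonneg p)
      _ = _ := by ring
  have t4 : (r-1-α) * b1 ≤ r * k :=
    aux_mul_le (r-1-α) r b1 k (by linarith) (by linarith) hb1 (by linarith)
  have t5 : (r-α) * b ≤ r * k :=
    aux_mul_le (r-α) r b k (by linarith) (by linarith) hb (by linarith)
  have t6 : -2 * (r-α) * x^2 + (r-1-α) * (x^2 + y^2) ≤ (-(1-α)) * x^2 + r * y^2 := by
    have u1 : 0 ≤ r * x^2 := mul_nonneg (by linarith) (sq_nonneg x)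
    have u2 : 0 ≤ (1+α) * y^2 := mul_nonneg (by linarith) (sq_nonneg y)
    linarith
  have e : (α * k + θ) * ((x - p)^2 - x^2) +
    ((r - 1 - α) * b1 * ((x + 1)^2 - x^2) + (r - α) * b * ((x - 1)^2 - x^2)) =
    ((α * k + θ) * (-2 * x * p) + ((r-1-α) * b1 * (2 * x) + (r - α) * b * (-2*x))) +
    (α * k + θ) * p^2 + (r-1-α) * b1 + (r-α) * b := by ring
  rw [e, lin]
  linarith

/-- quadratic drift, case `r ≥ 2` -/
lemma quad_drift (α θ r p p1 k b b1 : ℝ) (hα0 : 0 < α) (hα1 : α < 1) (hθ : 0 < α + θ) (hk : 1 ≤ k)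
    (hr : 2 ≤ r) (hb : b ≤ k) (hb0 : 0 ≤ b) (hb1 : b1 ≤ k)
    (hp : r * p = (r - 1 - α) * p1) :
    (α * k + θ) * ((b - p * k - p)^2 / ((k+1) * √(k+1)) - (b - p * k)^2 / (k * √k)) +
    ((r - 1 - α) * b1 * ((b - p * k + 1)^2 / (k * √k) - (b - p * k)^2 / (k * √k)) +
     (r - α) * b * ((b - p * k - 1)^2 / (k * √k) - (b - p * k)^2 / (k * √k))) ≤
    (- (1-α)) * ((b - p * k)^2 / (k * √k)) + r * ((b1 - p1 * k)^2 / (k * √k)) +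
      (2 * |θ| * |p| * (1 + |p|) + (α + |θ|) * p^2 + 2 * r) * (1 / √k) := by
  have hs : 0 < √k := Real.sqrt_pos.2 (by linarith)
  have hst : √k ≤ √(k+1) := Real.sqrt_le_sqrt (by linarith)
  have hks : 0 < k * √k := by positivity
  have hm : 0 < min α (α+θ) := lt_min hα0 hθ
  have h1 := aK_lower α θ k hk hα0
  have hnn : 0 ≤ α * k + θ := by nlinarith
  have e1 : (b - p * k - p)^2 / ((k+1) * √(k+1)) ≤ (b - p * k - p)^2 / (k * √k) := by
    apply div_le_div_of_nonneg_left (by positivity) hks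
    gcongr; linarith
  have e2 : (1 / √k) = k / (k * √k) := by field_simp
  rw [e2]
  have : (α * k + θ) * ((b - p * k - p)^2 / ((k+1) * √(k+1)) - (b - p * k)^2 / (k * √k)) ≤
     (α * k + θ) * ((b - p * k - p)^2 / (k * √k) - (b - p * k)^2 / (k * √k)) :=
    mul_le_mul_of_nonneg_left (by linarith) hnn
  refine (add_le_add_left this _).trans ?_
  set D := k * √k
  have goal' := quad_core α θ r p p1 k b b1 hα0 hα1 hk hr hb hb0 hb1 hp
  calc _ = ((α * k + θ) * ((b - p * k - p)^2 - (b - p * k)^2) +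
    ((r - 1 - α) * b1 * ((b - p * k + 1)^2 - (b - p * k)^2) +
     (r - α) * b * ((b - p * k - 1)^2 - (b - p * k)^2))) / D := by ring
    _ ≤ ((- (1-α)) * ((b - p * k)^2) + r * ((b1 - p1 * k)^2) +
      (2 * |θ| * |p| * (1 + |p|) + (α + |θ|) * p^2 + 2 * r) * k) / D := by gcongr
    _ = _ := by ring

/-- quadratic drift, case `r = 1` -/
lemma quad_drift1 (α θ k b : ℝ) (hα0 : 0 < α) (hα1 : α < 1) (hθ : 0 < α + θ) (hk : 1 ≤ k)
    (hb : b ≤ k) (hb0 : 0 ≤ b) :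
    (α * k + θ) * ((b - α * k + (1 - α))^2 / ((k+1) * √(k+1)) - (b - α * k)^2 / (k * √k)) +
     (1 - α) * b * ((b - α * k - 1)^2 / (k * √k) - (b - α * k)^2 / (k * √k)) ≤
    (- (1-α)) * ((b - α * k)^2 / (k * √k)) +
      (4 * |θ| + (α + |θ|) + 2) * (1 / √k) := by
  have hs : 0 < √k := Real.sqrt_pos.2 (by linarith)
  have hst : √k ≤ √(k+1) := Real.sqrt_le_sqrt (by linarith)
  have hks : 0 < k * √k := by positivity
  have hm : 0 < min α (α+θ) := lt_min hα0 hθ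
  have h1 := aK_lower α θ k hk hα0
  have hnn : 0 ≤ α * k + θ := by nlinarith
  have e1 : (b - α * k + (1 - α))^2 / ((k+1) * √(k+1)) ≤ (b - α * k + (1-α))^2 / (k * √k) := by
    apply div_le_div_of_nonneg_left (by positivity) hks
    gcongr; linarith
  have e2 : (1 / √k) = k / (k * √k) := by field_simp
  rw [e2]
  have : (α * k + θ) * ((b - α * k + (1 - α))^2 / ((k+1) * √(k+1)) - (b - α * k)^2 / (k * √k)) ≤
     (α * k + θ) * ((b - α * k + (1-α))^2 / (k * √k) - (b - α * k)^2 / (k * √k)) :=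
    mul_le_mul_of_nonneg_left (by linarith) hnn
  refine (add_le_add_left this _).trans ?_
  set D := k * √k
  have goal' : (α * k + θ) * ((b - α * k + (1-α))^2 - (b - α * k)^2) +
     (1 - α) * b * ((b - α * k - 1)^2 - (b - α * k)^2) ≤
    (- (1-α)) * ((b - α * k)^2) + (4 * |θ| + (α + |θ|) + 2) * k := by
    set x := b - α * k with hx
    have hbx : b = x + α * k := by rw [hx]; ring
    have hxk : |x| ≤ 2 * k := by rw [abs_le]; constructor <;> nlinarith
    have lin : (α * k + θ) * (2 * x * (1-α)) + (1 - α) * b * (-2*x) =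
        2 * θ * (1-α) * x - 2 * (1 - α) * x^2 := by
      rw [hbx]; ring
    have t1 : 2 * θ * (1-α) * x ≤ 4 * |θ| * k := by
      calc 2 * θ * (1-α) * x ≤ |2 * θ * (1-α) * x| := le_abs_self _
        _ = 2 * |θ| * (1-α) * |x| := by
          rw [abs_mul, abs_mul, abs_mul, abs_of_pos (by linarith : 0 < 1 - α)]; norm_num
        _ ≤ 2 * |θ| * 1 * (2 * k) := by gcongr; linarith
        _ = _ := by ring
    have t3 : (α * k + θ) * (1-α)^2 ≤ (α + |θ|) * k := by
      have : α * k + θ ≤ (α + |θ|) * k := by nlinarith [le_abs_self θ, abs_nonneg θ]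
      have h2 : (1-α)^2 ≤ 1 := by nlinarith
      nlinarith [sq_nonneg (1-α)]
    have t5 : (1-α) * b ≤ k := by nlinarith
    nlinarith [mul_nonneg (by linarith : 0 ≤ 1 - α) (sq_nonneg x)]
  calc _ = ((α * k + θ) * ((b - α * k + (1-α))^2 - (b - α * k)^2) +
     (1 - α) * b * ((b - α * k - 1)^2 - (b - α * k)^2)) / D := by ring
    _ ≤ ((- (1-α)) * ((b - α * k)^2) + (4 * |θ| + (α + |θ|) + 2) * k) / D := by gcongr
    _ = _ := by ring

/-- indicator of `r` -/
def dl (r : ℕ) : ℕ → ℝ := fun s => if s = r then 1 else 0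

lemma XX_dl {α : ℝ} {Ω : Type*} {K : ℕ → Ω → ℕ} {B : ℕ → ℕ → Ω → ℕ} (r : ℕ) (hr : 1 ≤ r)
    (n : ℕ) (ω : Ω) : XX α K B r (dl r) n ω = (B r n ω : ℝ) - sibuya α r * (K n ω : ℝ) := by
  simp [XX, dl, hr]

/-- `E[1/√K]` -/
def aE {Ω : Type*} {mΩ : MeasurableSpace Ω} (μ : Measure Ω) (K : ℕ → Ω → ℕ) (n : ℕ) : ℝ :=
  ∫ ω, 1 / √(K n ω : ℝ) ∂μ

/-- `E[X_r^2 / K^{3/2}]` -/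
def vE (α : ℝ) {Ω : Type*} {mΩ : MeasurableSpace Ω} (μ : Measure Ω) (K : ℕ → Ω → ℕ)
    (B : ℕ → ℕ → Ω → ℕ) (r n : ℕ) : ℝ :=
  ∫ ω, ((B r n ω : ℝ) - sibuya α r * (K n ω : ℝ))^2 / ((K n ω : ℝ) * √(K n ω : ℝ)) ∂μ

section EP
variable {α θ : ℝ} {Ω : Type*} {mΩ : MeasurableSpace Ω}
    {μ : Measure Ω} {F : Filtration ℕ mΩ} {K : ℕ → Ω → ℕ} {B : ℕ → ℕ → Ω → ℕ}

lemma aE_int (hEP : IsEwensPitman α θ μ F K B) (hα1 : α < 1) (hθ : 0 < α + θ) (n : ℕ)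
    (hn : 1 ≤ n) : Integrable (fun ω => 1 / √(K n ω : ℝ)) μ :=
  (EP_step hEP hα1 hθ (fun k _ => 1 / √(k:ℝ)) (fun _ => continuous_const) 1 le_rfl (fun _ => 0)
    rfl n hn).1

lemma vE_int (hEP : IsEwensPitman α θ μ F K B) (hα1 : α < 1) (hθ : 0 < α + θ) (r n : ℕ)
    (hr : 1 ≤ r) (hn : 1 ≤ n) : Integrable (fun ω => ((B r n ω : ℝ) - sibuya α r * (K n ω : ℝ))^2
      / ((K n ω : ℝ) * √(K n ω : ℝ))) μ := by
  have := (EP_step hEP hα1 hθ (fun k x => x^2 / ((k:ℝ) * √(k:ℝ))) (fun _ => by fun_prop) r hr (dl r)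
    (by simp [dl]) n hn).1
  simpa only [XX_dl r hr] using this

lemma n_theta_pos (hα1 : α < 1) (hθ : 0 < α + θ) (n : ℕ) (hn : 1 ≤ n) : 0 < (n:ℝ) + θ := by
  have : (1:ℝ) ≤ n := by exact_mod_cast hn
  linarith

lemma sumA (hEP : IsEwensPitman α θ μ F K B) (hα0 : 0 < α) (hα1 : α < 1) (hθ : 0 < α + θ) :
    Summable (fun n => aE μ K (n+1) * (((n+1 : ℕ):ℝ) + θ)⁻¹) := by
  have := hEP.prob
  refine summable_aux (fun n => aE μ K (n+1)) 0 _ (min α (α+θ) / 4)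
    (by have := lt_min hα0 hθ; positivity) (fun n => integral_nonneg fun ω => by positivity)
    (fun n => (inv_pos.2 (n_theta_pos hα1 hθ (n+1) (by omega))).le) (fun _ => le_rfl)
    (by simp [summable_zero]) ?_
  intro n
  have hn : 1 ≤ n + 1 := by omega
  obtain ⟨i1, i2, e⟩ := EP_step hEP hα1 hθ (fun k _ => 1 / √(k:ℝ)) (fun _ => continuous_const) 1
    le_rfl (fun _ => 0) rfl (n+1) hn
  have hp := inv_pos.2 (n_theta_pos hα1 hθ (n+1) hn)
  unfold aE
  rw [e]
  gcongr
  simp only [smul_eq_mul, Pi.zero_apply, add_zero]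
  rw [← integral_const_mul, ← integral_const_mul]
  refine integral_mono_ae i2 ((i1.const_mul _).const_mul _) ?_
  filter_upwards [EP_basic hEP (n+1) hn] with ω hω
  have hk : (1:ℝ) ≤ K (n+1) ω := by exact_mod_cast hω.1
  refine mul_le_mul_of_nonneg_left ?_ hp.le
  have := inv_sqrt_drift α θ _ hk hα0 hθ
  simpa [genE] using this

lemma sumV (hEP : IsEwensPitman α θ μ F K B) (hα0 : 0 < α) (hα1 : α < 1) (hθ : 0 < α + θ)
    (r : ℕ) (hr : 1 ≤ r) :
    Summable (fun n => vE α μ K B r (n+1) * (((n+1 : ℕ):ℝ) + θ)⁻¹) := by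
  have := hEP.prob
  have hA := sumA hEP hα0 hα1 hθ
  have hposn : ∀ n : ℕ, 0 < (((n+1 : ℕ):ℝ) + θ)⁻¹ :=
    fun n => inv_pos.2 (n_theta_pos hα1 hθ (n+1) (by omega))
  have ha0 : ∀ n, 0 ≤ aE μ K n := fun n => integral_nonneg fun ω => by positivity
  have hv0 : ∀ r n, 0 ≤ vE α μ K B r n := fun r n => integral_nonneg fun ω => by positivity
  induction r, hr using Nat.le_induction with
  | base =>
    refine summable_aux (fun n => vE α μ K B 1 (n+1))
      (fun n => (4 * |θ| + (α + |θ|) + 2) * aE μ K (n+1)) _ (1 - α)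
      (by linarith) (fun n => hv0 _ _) (fun n => (hposn n).le)
      (fun n => mul_nonneg (by positivity) (ha0 _)) ?_ ?_
    · simpa only [mul_assoc] using hA.mul_left (4 * |θ| + (α + |θ|) + 2)
    intro n
    have hn : 1 ≤ n + 1 := by omega
    obtain ⟨i1, i2, e⟩ := EP_step hEP hα1 hθ (fun k x => x^2 / ((k:ℝ) * √(k:ℝ)))
      (fun _ => by fun_prop) 1 le_rfl (dl 1) (by simp [dl]) (n+1) hn
    simp only [XX_dl 1 le_rfl] at i1 i2 e
    unfold vE aE
    rw [e]
    gcongr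
    rw [← integral_const_mul, ← integral_const_mul, ← integral_add (i1.const_mul _)
      ((aE_int hEP hα1 hθ (n+1) hn).const_mul _), ← integral_const_mul]
    refine integral_mono_ae i2 (((i1.const_mul _).add
      ((aE_int hEP hα1 hθ (n+1) hn).const_mul _)).const_mul _) ?_
    filter_upwards [EP_basic hEP (n+1) hn] with ω hω
    have hk : (1:ℝ) ≤ K (n+1) ω := by exact_mod_cast hω.1
    have hb : (B 1 (n+1) ω : ℝ) ≤ K (n+1) ω := by exact_mod_cast hω.2.2 1 le_rfl
    refine mul_le_mul_of_nonneg_left ?_ (hposn n).le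
    have := quad_drift1 α θ _ _ hα0 hα1 hθ hk hb (Nat.cast_nonneg _)
    simp only [genE, Finset.Icc_self, Finset.sum_singleton, dl, ff1, sibuya_one, smul_eq_mul,
      Pi.add_apply]
    simp only [if_true, one_mul, Nat.cast_one, Nat.cast_add, show ¬ (1 + 1 = 1) by norm_num, if_false,
      zero_sub, ← sub_eq_add_neg]
    exact this
  | succ q hq ih =>
    set C := (2 * |θ| * |sibuya α (q+1)| * (1 + |sibuya α (q+1)|) + (α + |θ|) * (sibuya α (q+1))^2
      + 2 * ((q:ℝ) + 1)) with hC
    refine summable_aux (fun n => vE α μ K B (q+1) (n+1))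
      (fun n => ((q:ℝ)+1) * vE α μ K B q (n+1) + C * aE μ K (n+1)) _ (1 - α)
      (by linarith) (fun n => hv0 _ _) (fun n => (hposn n).le)
      (fun n => add_nonneg (mul_nonneg (by positivity) (hv0 _ _))
        (mul_nonneg (by positivity) (ha0 _))) ?_ ?_
    · have := (ih.mul_left ((q:ℝ)+1)).add (hA.mul_left C)
      refine this.congr fun n => ?_
      ring
    intro n
    have hn : 1 ≤ n + 1 := by omega
    obtain ⟨i1, i2, e⟩ := EP_step hEP hα1 hθ (fun k x => x^2 / ((k:ℝ) * √(k:ℝ)))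
      (fun _ => by fun_prop) (q+1) (by omega) (dl (q+1)) (by simp [dl]) (n+1) hn
    simp only [XX_dl (q+1) (by omega)] at i1 i2 e
    have i3 := vE_int hEP hα1 hθ q (n+1) hq hn
    have i4 := aE_int hEP hα1 hθ (n+1) hn
    unfold vE aE
    rw [e]
    gcongr
    rw [← integral_const_mul, ← integral_const_mul, ← integral_const_mul,
      ← integral_add (i3.const_mul _) (i4.const_mul _)]
    have e5 := integral_add (i1.const_mul (-(1-α))) ((i3.const_mul ((q:ℝ)+1)).add (i4.const_mul C))
    simp only [Pi.add_apply] at e5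
    rw [← e5, ← integral_const_mul]
    refine integral_mono_ae i2 (((i1.const_mul _).add
      ((i3.const_mul _).add (i4.const_mul _))).const_mul _) ?_
    filter_upwards [EP_basic hEP (n+1) hn] with ω hω
    have hk : (1:ℝ) ≤ K (n+1) ω := by exact_mod_cast hω.1
    have hb : (B (q+1) (n+1) ω : ℝ) ≤ K (n+1) ω := by exact_mod_cast hω.2.2 (q+1) (by omega)
    have hb1 : (B q (n+1) ω : ℝ) ≤ K (n+1) ω := by exact_mod_cast hω.2.2 q hq
    refine mul_le_mul_of_nonneg_left ?_ (hposn n).le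
    have hq' : (1:ℝ) ≤ q := by exact_mod_cast hq
    have := quad_drift α θ ((q:ℝ)+1) (sibuya α (q+1)) (sibuya α q) _ _ _ hα0 hα1 hθ hk
      (by linarith) hb (Nat.cast_nonneg _) hb1 (by rw [sibuya_succ α q hq]; ring)
    have hf : ff1 α (q+1) (dl (q+1)) = - sibuya α (q+1) := by
      have h1 : ¬ (1 = q + 1) := by omega
      simp [ff1, dl, show q ≠ 0 by omega]
    obtain ⟨s, rfl⟩ : ∃ s, q = s + 1 := ⟨q - 1, by omega⟩
    simp only [genE, smul_eq_mul, hf, Pi.add_apply]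
    rw [Finset.sum_Icc_succ_top (by omega), Finset.sum_Icc_succ_top (by omega),
      Finset.sum_eq_zero, zero_add]
    · simp only [dl, show ¬ (s+1+1+1 = s+1+1) by omega, show ¬ (s+1 = s+1+1) by omega, if_true,
        if_false, sub_zero, zero_sub, ← sub_eq_add_neg]
      push_cast at this ⊢
      rw [hC]
      push_cast
      simp only [add_sub_cancel_right] at this
      refine le_trans (le_of_eq ?_) (this.trans (le_of_eq ?_))
      · ring
      · ring
    · intro t ht
      have := (Finset.mem_Icc.1 ht).2
      simp [dl, show t ≠ s + 1 by omega, show t ≠ s+1+1 by omega]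

/-- total error -/
def epsE (α : ℝ) {Ω : Type*} {mΩ : MeasurableSpace Ω} (μ : Measure Ω) (K : ℕ → Ω → ℕ)
    (B : ℕ → ℕ → Ω → ℕ) (d n : ℕ) : ℝ :=
  ∫ ω, (1 / √(K n ω : ℝ) + ∑ r ∈ Finset.Icc 1 d,
    |(B r n ω : ℝ) / (K n ω : ℝ) - sibuya α r|) ∂μ

lemma absW (k b p : ℝ) (hk : 1 ≤ k) :
    |b / k - p| ≤ (b - p * k)^2 / (k * √k) + 1 / √k := by
  have hs : 0 < √k := Real.sqrt_pos.2 (by linarith)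
  have hs2 : √k ^ 2 = k := Real.sq_sqrt (by linarith)
  have : |b / k - p| = |b - p * k| / (√k)^2 := by
    rw [hs2, ← abs_of_pos (show 0 < k by linarith), ← abs_div, abs_of_pos (show 0 < k by linarith)]
    congr 1; field_simp
  rw [this, ← sq_abs (b - p*k)]
  set x := |b - p * k|
  have hx : 0 ≤ x := abs_nonneg _
  rw [show k * √k = √k ^ 3 by rw [pow_succ, hs2]]
  set s := √k
  rw [show x^2 / s^3 + 1 / s = (x^2 + s^2) / s^3 by field_simp, div_le_div_iff₀ (by positivity)
    (by positivity)]
  nlinarith [sq_nonneg (x - s), pow_pos hs 2, mul_nonneg hx hs.le, sq_nonneg x]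

lemma epsE_int (hEP : IsEwensPitman α θ μ F K B) (hα1 : α < 1) (hθ : 0 < α + θ) (d n : ℕ)
    (hn : 1 ≤ n) : Integrable (fun ω => (1 / √(K n ω : ℝ) + ∑ r ∈ Finset.Icc 1 d,
    |(B r n ω : ℝ) / (K n ω : ℝ) - sibuya α r|)) μ := by
  have := hEP.prob
  refine (aE_int hEP hα1 hθ n hn).add (integrable_finsetSum _ fun r hr => ?_)
  have hr := (Finset.mem_Icc.1 hr).1
  refine (((vE_int hEP hα1 hθ r n hr hn).add (aE_int hEP hα1 hθ n hn))).mono' ?_ ?_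
  · have hK := EP_measK hEP n
    have hB := EP_measB hEP r n
    have hK' : Measurable (fun ω => (K n ω : ℝ)) := (Measurable.of_discrete).comp hK
    have hB' : Measurable (fun ω => (B r n ω : ℝ)) := (Measurable.of_discrete).comp hB
    exact (((hB'.div hK').sub_const _).abs).aestronglyMeasurable
  · filter_upwards [EP_basic hEP n hn] with ω hω
    have hk : (1:ℝ) ≤ K n ω := by exact_mod_cast hω.1
    rw [Real.norm_eq_abs, abs_abs]
    exact absW _ _ _ hk

lemma sumEps (hEP : IsEwensPitman α θ μ F K B) (hα0 : 0 < α) (hα1 : α < 1) (hθ : 0 < α + θ)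
    (d : ℕ) :
    Summable (fun n => epsE α μ K B d (n+1) * (((n+1 : ℕ):ℝ) + θ)⁻¹) := by
  have := hEP.prob
  have hA := sumA hEP hα0 hα1 hθ
  have hposn : ∀ n : ℕ, 0 < (((n+1 : ℕ):ℝ) + θ)⁻¹ :=
    fun n => inv_pos.2 (n_theta_pos hα1 hθ (n+1) (by omega))
  have hsum : Summable (fun n => aE μ K (n+1) * (((n+1 : ℕ):ℝ) + θ)⁻¹ +
      ∑ r ∈ Finset.Icc 1 d, (vE α μ K B r (n+1) * (((n+1 : ℕ):ℝ) + θ)⁻¹ +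
        aE μ K (n+1) * (((n+1 : ℕ):ℝ) + θ)⁻¹)) :=
    hA.add (summable_sum fun r hr =>
      (sumV hEP hα0 hα1 hθ r (Finset.mem_Icc.1 hr).1).add hA)
  refine Summable.of_nonneg_of_le (fun n => mul_nonneg (integral_nonneg fun ω => by positivity)
    (hposn n).le) (fun n => ?_) hsum
  have hn : 1 ≤ n + 1 := by omega
  simp only [← add_mul, ← Finset.sum_mul]
  refine mul_le_mul_of_nonneg_right ?_ (hposn n).le
  have i4 := aE_int hEP hα1 hθ (n+1) hn
  have i3 : ∀ r ∈ Finset.Icc 1 d, _ := fun r hr =>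
    (vE_int hEP hα1 hθ r (n+1) (Finset.mem_Icc.1 hr).1 hn).add i4
  have e : ∑ r ∈ Finset.Icc 1 d, (vE α μ K B r (n+1) + aE μ K (n+1)) =
      ∑ r ∈ Finset.Icc 1 d, ∫ ω, (((B r (n+1) ω : ℝ) - sibuya α r * (K (n+1) ω : ℝ))^2
        / ((K (n+1) ω : ℝ) * √(K (n+1) ω : ℝ)) + 1 / √(K (n+1) ω : ℝ)) ∂μ := by
    refine Finset.sum_congr rfl fun r hr => ?_
    rw [integral_add (vE_int hEP hα1 hθ r (n+1) (Finset.mem_Icc.1 hr).1 hn) i4]; rfl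
  simp only [Pi.add_def] at i3
  rw [e, ← integral_finsetSum _ i3, aE, ← integral_add i4 (integrable_finsetSum _ i3), epsE]
  refine integral_mono_ae (epsE_int hEP hα1 hθ d (n+1) hn) (i4.add (integrable_finsetSum _ i3)) ?_
  filter_upwards [EP_basic hEP (n+1) hn] with ω hω
  have hk : (1:ℝ) ≤ K (n+1) ω := by exact_mod_cast hω.1
  gcongr
  exact absW _ _ _ hk
end EP

lemma exp_rem3 (δ D : ℝ) (h : |δ| ≤ D) :
    ‖Complex.exp (Complex.I * δ) - 1 - Complex.I * δ + (δ:ℂ)^2 / 2‖ ≤ |δ|^3 * Real.exp D := by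
  have := Complex.norm_exp_sub_sum_le_norm_mul_exp (Complex.I * δ) 3
  simp only [Finset.sum_range_succ, Finset.sum_range_zero, Nat.factorial, norm_mul, Complex.norm_I,
    one_mul, Complex.norm_real, Real.norm_eq_abs] at this
  refine le_trans (le_of_eq ?_) (this.trans ?_)
  · congr 1
    have hI : (Complex.I * (δ:ℂ))^2 = - (δ:ℂ)^2 := by rw [mul_pow, Complex.I_sq]; ring
    rw [hI]
    push_cast
    ring
  · gcongr

lemma sqrt_diff (k : ℝ) (hk : 1 ≤ k) :
    |1 / √(k+1) - 1 / √k| ≤ 1 / (k * √k) ∧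
    |1 / √(k+1) - 1 / √k + 1 / (2 * k * √k)| ≤ 1 / (k * k * √k) := by
  have hs : 0 < √k := Real.sqrt_pos.2 (by linarith)
  have ht : 0 < √(k+1) := Real.sqrt_pos.2 (by linarith)
  have hs2 : √k ^ 2 = k := Real.sq_sqrt (by linarith)
  have ht2 : √(k+1) ^ 2 = k + 1 := Real.sq_sqrt (by linarith)
  have hst : √k ≤ √(k+1) := Real.sqrt_le_sqrt (by linarith)
  set s := √k
  set t := √(k+1)
  have e1 : 1 / t - 1 / s = - (1 / (s * t * (s + t))) := by
    field_simp
    nlinarith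
  have hts : t - s = 1 / (s + t) := by
    field_simp; nlinarith
  rw [e1]
  constructor
  · rw [abs_neg, abs_of_pos (by positivity)]
    apply one_div_le_one_div_of_le (by positivity)
    have : k ≤ t * (s+t) := by nlinarith
    nlinarith
  · have e2 : -(1 / (s * t * (s + t))) + 1 / (2 * k * s) =
        (2 * s + t) / (2 * k * s * t * (s+t)^2) := by
      have : 1 = (t - s) * (s + t) := by nlinarith
      rw [← hs2]
      field_simp
      nlinarith
    rw [e2, abs_of_pos (by positivity), div_le_div_iff₀ (by positivity) (by positivity)]
    have h1 : 2 * s + t ≤ 2 * (s + t) := by linarith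
    have h2 : k ≤ t * (s + t) := by nlinarith
    have hk0 : 0 < k := by linarith
    calc (2 * s + t) * (k * k * s) ≤ (2 * (s + t)) * (k * (t * (s + t)) * s) := by gcongr
      _ = 1 * (2 * k * s * t * (s+t)^2) := by ring

set_option maxHeartbeats 1000000 in
lemma new_est (α θ M : ℝ) (hα0 : 0 < α) (hM : 0 ≤ M) (k f w : ℝ) (hk : 1 ≤ k) (hf : |f| ≤ M)
    (hw : |w| ≤ M) :
    ‖((α * k + θ : ℝ):ℂ) * (Complex.exp (Complex.I * ((k * w + f) / √(k+1) - k * w / √k : ℝ)) - 1)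
      - (Complex.I * ((α * k * f - α * k * w / 2) / √k : ℝ) - (α * f^2 / 2 : ℝ))‖ ≤
    ((α + |θ|) * (64 * M^3 * Real.exp (4 * M)) + (2 * α * M + 4 * |θ| * M) +
      (6 * α * M^2 + 8 * |θ| * M^2) + α * M) * (1 / √k + |w|) := by
  have hs : 0 < √k := Real.sqrt_pos.2 (by linarith)
  have hs1 : 1 ≤ √k := Real.one_le_sqrt.2 hk
  have hs2 : √k ^ 2 = k := Real.sq_sqrt (by linarith)
  obtain ⟨q1, q2⟩ := sqrt_diff k hk
  set D := (k * w + f) / √(k+1) - k * w / √k with hD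
  set s := √k
  set D1 := (f - w / 2) / s with hD1
  have hk0 : 0 < k := by linarith
  have he : |D - D1| ≤ 2 * M / (k * s) := by
    have : D - D1 = (k * w) * (1 / √(k+1) - 1 / s + 1 / (2 * k * s)) + f * (1 / √(k+1) - 1 / s) := by
      rw [hD, hD1]; field_simp; ring
    rw [this]
    refine (abs_add_le _ _).trans ?_
    rw [abs_mul, abs_mul, abs_mul, abs_of_pos hk0]
    calc _ ≤ (k * M) * (1 / (k * k * s)) + M * (1 / (k * s)) := by gcongr
      _ = 2 * M / (k * s) := by field_simp; ring
  have hfw : |f - w / 2| ≤ 3 / 2 * M := by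
    rw [abs_le] at *; constructor <;> linarith
  have hD1b : |D1| ≤ (3 / 2 * M) / s := by
    rw [hD1, abs_div, abs_of_pos hs]; gcongr
  have hks : 1 / (k * s) ≤ 1 / s := by
    apply one_div_le_one_div_of_le hs; nlinarith
  have he' : |D - D1| ≤ 2 * M / s := by
    refine he.trans ?_
    rw [div_eq_mul_one_div, div_eq_mul_one_div (2 * M)]; gcongr
  have hDb : |D| ≤ 4 * M / s := by
    have : D = (D - D1) + D1 := by ring
    rw [this]
    refine (abs_add_le _ _).trans ((add_le_add he' hD1b).trans ?_)
    rw [← add_div]; gcongr; linarith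
  have hDb' : |D| ≤ 4 * M := hDb.trans (div_le_self (by positivity) hs1)
  have r3 := exp_rem3 D (4 * M) hDb'
  have key : ((α * k + θ : ℝ):ℂ) * (Complex.exp (Complex.I * (D:ℝ)) - 1)
      - (Complex.I * ((α * k * f - α * k * w / 2) / s : ℝ) - (α * f^2 / 2 : ℝ)) =
      ((α * k + θ : ℝ):ℂ) * (Complex.exp (Complex.I * D) - 1 - Complex.I * D + (D:ℂ)^2 / 2) +
      Complex.I * ((α * k * (D - D1) + θ * D : ℝ) : ℂ) +
      ((- (α * (k * (D - D1) * (D + D1)) / 2 + θ * D^2 / 2) : ℝ) : ℂ) +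
      ((α * (f * w - w^2 / 4) / 2 : ℝ) : ℂ) := by
    have e1 : (α * k * f - α * k * w / 2) / s = α * k * D1 := by rw [hD1]; ring
    have e2 : α * (f * w - w^2 / 4) / 2 = α * f^2 / 2 - α * k * D1^2 / 2 := by
      have : k * D1^2 = (f - w/2)^2 := by
        rw [hD1, div_pow, hs2]; field_simp
      linear_combination (α / 2) * this
    rw [e1, e2]
    push_cast
    ring
  rw [key]
  have hs3 : k / s^3 = 1 / s := by rw [← hs2]; field_simp
  have hs31 : 1 / s^3 ≤ 1 / s := by
    apply one_div_le_one_div_of_le hs; nlinarith [mul_self_nonneg s]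
  have n1 : ‖((α * k + θ : ℝ):ℂ) * (Complex.exp (Complex.I * D) - 1 - Complex.I * D + (D:ℂ)^2 / 2)‖
      ≤ (α + |θ|) * (64 * M^3 * Real.exp (4 * M)) * (1 / s) := by
    rw [norm_mul, Complex.norm_real, Real.norm_eq_abs]
    have a1 : |α * k + θ| ≤ (α + |θ|) * k := by
      refine (abs_add_le _ _).trans ?_
      rw [abs_of_pos (by positivity)]
      nlinarith [abs_nonneg θ]
    calc _ ≤ ((α + |θ|) * k) * (|D|^3 * Real.exp (4 * M)) := by gcongr
      _ ≤ ((α + |θ|) * k) * ((4 * M / s)^3 * Real.exp (4 * M)) := by gcongr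
      _ = (α + |θ|) * (64 * M^3 * Real.exp (4 * M)) * (k / s^3) := by ring
      _ = _ := by rw [hs3]
  have n2 : ‖Complex.I * ((α * k * (D - D1) + θ * D : ℝ) : ℂ)‖ ≤ (2 * α * M + 4 * |θ| * M) * (1 / s) := by
    rw [norm_mul, Complex.norm_I, one_mul, Complex.norm_real, Real.norm_eq_abs]
    refine (abs_add_le _ _).trans ?_
    rw [abs_mul, abs_mul θ, abs_of_pos (show 0 < α * k by positivity)]
    calc _ ≤ α * k * (2 * M / (k * s)) + |θ| * (4 * M / s) := by gcongr
      _ = _ := by field_simp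
  have hss : 1 / s * (1 / s) ≤ 1 / s := by
    have : 1 / s ≤ 1 := by rw [div_le_one hs]; exact hs1
    nlinarith [show 0 < 1 / s by positivity]
  have n3 : ‖((- (α * (k * (D - D1) * (D + D1)) / 2 + θ * D^2 / 2) : ℝ) : ℂ)‖ ≤
      (6 * α * M^2 + 8 * |θ| * M^2) * (1 / s) := by
    rw [Complex.norm_real, Real.norm_eq_abs, abs_neg]
    refine (abs_add_le _ _).trans ?_
    have hDD : |D + D1| ≤ 6 * M / s := by
      refine (abs_add_le _ _).trans ((add_le_add hDb hD1b).trans ?_)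
      rw [← add_div]; gcongr; linarith
    have b1 : |α * (k * (D - D1) * (D + D1)) / 2| ≤ 6 * α * M^2 * (1/s) := by
      rw [abs_div, abs_mul, abs_mul, abs_mul, abs_of_pos hα0, abs_of_pos hk0, abs_two]
      calc _ ≤ α * (k * (2 * M / (k * s)) * (6 * M / s)) / 2 := by gcongr
        _ = 6 * α * M^2 * (1/s * (1 / s)) := by field_simp; try ring
        _ ≤ _ := by gcongr
    have b2 : |θ * D^2 / 2| ≤ 8 * |θ| * M^2 * (1/s) := by
      rw [abs_div, abs_mul, abs_pow, abs_two]
      calc _ ≤ |θ| * (4 * M / s)^2 / 2 := by gcongr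
        _ = 8 * |θ| * M^2 * (1/s * (1 / s)) := by field_simp; try ring
        _ ≤ _ := by gcongr
    linarith
  have n4 : ‖((α * (f * w - w^2 / 4) / 2 : ℝ) : ℂ)‖ ≤ α * M * |w| := by
    rw [Complex.norm_real, Real.norm_eq_abs]
    have : α * (f * w - w^2 / 4) / 2 = α * ((f - w / 4) / 2) * w := by ring
    rw [this, abs_mul, abs_mul, abs_of_pos hα0]
    gcongr
    rw [abs_le] at *; constructor <;> linarith
  refine (norm_add_le _ _).trans ?_
  refine (add_le_add ((norm_add_le _ _).trans (add_le_add ((norm_add_le _ _).trans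
    (add_le_add n1 n2)) n3)) n4).trans ?_
  have c1 : 0 ≤ 1 / s := by positivity
  have c2 := abs_nonneg w
  have c3 : 0 ≤ (α + |θ|) * (64 * M^3 * Real.exp (4 * M)) + (2 * α * M + 4 * |θ| * M) +
      (6 * α * M^2 + 8 * |θ| * M^2) := by positivity
  have c4 : 0 ≤ α * M := by positivity
  nlinarith [mul_nonneg c3 c2, mul_nonneg c4 c1]

lemma grow_est (a M : ℝ) (ha : 0 ≤ a) (hM : 0 ≤ M) (k b p g : ℝ) (hk : 1 ≤ k) (hb0 : 0 ≤ b)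
    (hb : b ≤ k) (hg : |g| ≤ M) :
    ‖((a * b : ℝ):ℂ) * (Complex.exp (Complex.I * (g / √k : ℝ)) - 1)
      - (Complex.I * (a * b * g / √k : ℝ) - (a * p * g^2 / 2 : ℝ))‖ ≤
    (a * M^3 * Real.exp M + a * M^2) * (1 / √k + |b / k - p|) := by
  have hs : 0 < √k := Real.sqrt_pos.2 (by linarith)
  have hs1 : 1 ≤ √k := Real.one_le_sqrt.2 hk
  have hs2 : √k ^ 2 = k := Real.sq_sqrt (by linarith)
  set s := √k
  have hk0 : 0 < k := by linarith
  have hD : |g / s| ≤ M / s := by rw [abs_div, abs_of_pos hs]; gcongr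
  have r3 := exp_rem3 (g/s) M (hD.trans (div_le_self hM hs1))
  have key : ((a * b : ℝ):ℂ) * (Complex.exp (Complex.I * (g / s : ℝ)) - 1)
      - (Complex.I * (a * b * g / s : ℝ) - (a * p * g^2 / 2 : ℝ)) =
      ((a * b : ℝ):ℂ) * (Complex.exp (Complex.I * (g / s : ℝ)) - 1 - Complex.I * (g / s : ℝ)
        + ((g / s : ℝ):ℂ)^2/2) + ((- (a * (b / k - p) * g^2 / 2) : ℝ) : ℂ) := by
    have : a * (b / k - p) * g^2 / 2 = a * b * (g / s)^2 / 2 - a * p * g^2 / 2 := by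
      rw [div_pow, hs2]; ring
    rw [this, show a * b * g / s = a * b * (g / s) by ring]
    push_cast
    ring
  rw [key]
  have hs3 : k / s^3 = 1 / s := by rw [← hs2]; field_simp
  have n1 : ‖((a * b : ℝ):ℂ) * (Complex.exp (Complex.I * (g / s : ℝ)) - 1 - Complex.I * (g / s : ℝ)
        + ((g / s : ℝ):ℂ)^2/2)‖ ≤ a * M^3 * Real.exp M * (1/s) := by
    rw [norm_mul, Complex.norm_real, Real.norm_eq_abs, abs_of_nonneg (by positivity)]
    calc _ ≤ (a * k) * ((M / s)^3 * Real.exp M) := by gcongr; exact r3.trans (by gcongr)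
      _ = a * M^3 * Real.exp M * (k / s^3) := by ring
      _ = _ := by rw [hs3]
  have n2 : ‖((- (a * (b / k - p) * g^2 / 2) : ℝ) : ℂ)‖ ≤ a * M^2 * |b / k - p| := by
    rw [Complex.norm_real, Real.norm_eq_abs, abs_neg, abs_div, abs_mul, abs_mul, abs_pow,
      abs_of_nonneg ha, abs_two]
    calc _ ≤ a * |b / k - p| * M^2 / 2 := by gcongr
      _ ≤ a * M^2 * |b / k - p| := by nlinarith [show 0 ≤ a * M^2 * |b / k - p| by positivity]
  refine (norm_add_le _ _).trans ((add_le_add n1 n2).trans ?_)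
  have c1 : 0 ≤ 1 / s := by positivity
  have c2 := abs_nonneg (b / k - p)
  have c3 : 0 ≤ a * M^3 * Real.exp M := by positivity
  have c4 : 0 ≤ a * M^2 := by positivity
  nlinarith [mul_nonneg c3 c2, mul_nonneg c4 c1]

/-- Limiting quadratic form. -/
def gq (α : ℝ) (d : ℕ) (h : ℕ → ℝ) : ℝ :=
  ∑ r ∈ Finset.Icc 1 d, sibuya α r * h r ^ 2 - (∑ r ∈ Finset.Icc 1 d, h r * sibuya α r) ^ 2

/-- Drift operator. -/
def LL (α : ℝ) (d : ℕ) (h : ℕ → ℝ) (r : ℕ) : ℝ :=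
  if 1 ≤ r ∧ r ≤ d then ((r:ℝ) - α) * (h (r+1) - h r) - α / 2 * h r else 0

/-- Quadratic variation form. -/
def QQ (α : ℝ) (d : ℕ) (h : ℕ → ℝ) : ℝ :=
  α * ff1 α d h ^ 2 + ∑ r ∈ Finset.Icc 1 d, ((r:ℝ) - α) * sibuya α r * (h (r+1) - h r) ^ 2

lemma sib_tel (α : ℝ) (d : ℕ) (g : ℕ → ℝ) :
    ∑ r ∈ Finset.Icc 1 d, sibuya α r * (((r:ℝ) - α) * (g (r+1) - g r)) =
      ((d:ℝ)+1) * sibuya α (d+1) * g (d+1) - α * g 1 + α * ∑ r ∈ Finset.Icc 1 d, sibuya α r * g r := by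
  induction d with
  | zero => simp [sibuya_one]
  | succ d ih =>
    rw [Finset.sum_Icc_succ_top (by omega), Finset.sum_Icc_succ_top (by omega), ih]
    have := sibuya_succ α (d+1) (by omega)
    push_cast at this ⊢
    linear_combination (- g (d+1+1)) * this

lemma gq_LL (α : ℝ) (d : ℕ) (h : ℕ → ℝ) (hh : h (d+1) = 0) (t : ℝ) :
    gq α d (fun r => h r + t * LL α d h r) = gq α d h - t * QQ α d h + t^2 * gq α d (LL α d h) := by
  have t1 := sib_tel α d h
  have t2 := sib_tel α d (fun r => h r ^ 2)
  rw [hh] at t1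
  simp only [hh] at t2
  set S := ∑ r ∈ Finset.Icc 1 d, sibuya α r * h r with hS
  have eS : ∑ r ∈ Finset.Icc 1 d, h r * sibuya α r = S :=
    Finset.sum_congr rfl fun r _ => mul_comm _ _
  have eL : ∑ r ∈ Finset.Icc 1 d, LL α d h r * sibuya α r = - α * (h 1 - S) - α / 2 * S := by
    have : ∑ r ∈ Finset.Icc 1 d, LL α d h r * sibuya α r =
        ∑ r ∈ Finset.Icc 1 d, (sibuya α r * (((r:ℝ) - α) * (h (r+1) - h r))
          - α / 2 * (sibuya α r * h r)) := by
      refine Finset.sum_congr rfl fun r hr => ?_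
      rw [LL, if_pos (Finset.mem_Icc.1 hr)]; ring
    rw [this, Finset.sum_sub_distrib, t1, ← Finset.mul_sum]; ring
  have ehL : 2 * ∑ r ∈ Finset.Icc 1 d, sibuya α r * (h r * LL α d h r) =
      - α * h 1 ^ 2 - ∑ r ∈ Finset.Icc 1 d, ((r:ℝ) - α) * sibuya α r * (h (r+1) - h r) ^ 2 := by
    have : 2 * ∑ r ∈ Finset.Icc 1 d, sibuya α r * (h r * LL α d h r) =
        ∑ r ∈ Finset.Icc 1 d, (sibuya α r * (((r:ℝ) - α) * (h (r+1)^2 - h r^2))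
          - ((r:ℝ) - α) * sibuya α r * (h (r+1) - h r) ^ 2
          - α * (sibuya α r * h r^2)) := by
      rw [Finset.mul_sum]
      refine Finset.sum_congr rfl fun r hr => ?_
      rw [LL, if_pos (Finset.mem_Icc.1 hr)]; ring
    rw [this, Finset.sum_sub_distrib, Finset.sum_sub_distrib, t2, ← Finset.mul_sum]; ring
  have e1 : ∑ r ∈ Finset.Icc 1 d, sibuya α r * (h r + t * LL α d h r)^2 =
      ∑ r ∈ Finset.Icc 1 d, sibuya α r * h r^2 +
      t * (2 * ∑ r ∈ Finset.Icc 1 d, sibuya α r * (h r * LL α d h r)) +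
      t^2 * ∑ r ∈ Finset.Icc 1 d, sibuya α r * (LL α d h r)^2 := by
    rw [Finset.mul_sum, Finset.mul_sum, Finset.mul_sum, ← Finset.sum_add_distrib,
      ← Finset.sum_add_distrib]
    exact Finset.sum_congr rfl fun r _ => by ring
  have e2 : ∑ r ∈ Finset.Icc 1 d, (h r + t * LL α d h r) * sibuya α r =
      S + t * ∑ r ∈ Finset.Icc 1 d, LL α d h r * sibuya α r := by
    rw [← eS, Finset.mul_sum, ← Finset.sum_add_distrib]
    exact Finset.sum_congr rfl fun r _ => by ring
  simp only [gq, QQ, ff1]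
  rw [e1, e2, ehL, eL, eS]
  ring

set_option maxHeartbeats 1000000 in
lemma expB (A c1 c2 c3 c4 : ℝ) (hA : 0 ≤ A) (h1 : 0 ≤ c1) (h2 : 0 ≤ c2) (h3 : 0 ≤ c3) (h4 : 0 ≤ c4)
    (m k w W Q Γ : ℝ) (G : ℂ) (hm : 0 < m) (hk : 1 ≤ k) (hkm : k ≤ A * m)
    (hw : |w| ≤ c1 * W) (hW0 : 0 ≤ W) (hW : W ≤ c2) (hQ : |Q| ≤ c3) (hΓ : |Γ| ≤ c4) :
    ‖1 + (m⁻¹ : ℝ) * G - Complex.exp (Complex.I * (√k * w / m : ℝ)) *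
      Complex.exp (-(Q / (2 * m) - Γ / (2 * m^2) : ℝ))‖ ≤
    m⁻¹ * (‖G - (Complex.I * (√k * w : ℝ) - (Q / 2 : ℝ))‖ +
      (c4 * A + Real.exp (c1 * c2 * A + (c3 + c4 * A) * A) *
        (2 * A * c1^2 * c2 + 2 * (c3 + c4 * A)^2 * A)) * (1 / √k + W)) := by
  have hs : 0 < √k := Real.sqrt_pos.2 (by linarith)
  have hs1 : 1 ≤ √k := Real.one_le_sqrt.2 hk
  have hs2 : √k ^ 2 = k := Real.sq_sqrt (by linarith)
  set s := √k
  have hk0 : 0 < k := by linarith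
  have hsk : s ≤ k := by nlinarith
  have hmi : 0 < m⁻¹ := inv_pos.2 hm
  have hmk : m⁻¹ ≤ A / k := by
    rw [le_div_iff₀ hk0, inv_mul_le_iff₀ hm]; linarith
  have hms : m⁻¹ ≤ A * (1 / s) := by
    refine hmk.trans ?_
    rw [← div_eq_mul_one_div]; gcongr
  have hmA : m⁻¹ ≤ A := hmk.trans (div_le_self hA hk)
  have hksm : s * m⁻¹ ≤ A := by
    calc s * m⁻¹ ≤ k * m⁻¹ := by gcongr
      _ ≤ k * (A / k) := by gcongr
      _ = A := by field_simp
  have hkm1 : k * m⁻¹ ≤ A := by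
    calc k * m⁻¹ ≤ k * (A / k) := by gcongr
      _ = A := by field_simp
  have hcW : 0 ≤ c1 * W := (abs_nonneg _).trans hw
  set c5 := c3 + c4 * A with hc5
  have hc50 : 0 ≤ c5 := by positivity
  set q := Q / (2 * m) - Γ / (2 * m^2) with hq
  have hqb : |q| ≤ c5 * m⁻¹ := by
    have : q = (Q / 2 - Γ * m⁻¹ / 2) * m⁻¹ := by rw [hq]; field_simp
    rw [this, abs_mul, abs_of_pos hmi]
    gcongr
    refine (abs_sub _ _).trans ?_
    rw [abs_div, abs_div, abs_mul, abs_two, abs_of_pos hmi]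
    have : |Γ| * m⁻¹ ≤ c4 * A := by gcongr
    have := abs_nonneg Γ
    nlinarith [abs_nonneg Q, show 0 ≤ |Γ| * m⁻¹ by positivity]
  set z : ℂ := Complex.I * (s * w / m : ℝ) + (-(q:ℝ) : ℂ) with hz
  have ez : Complex.exp (Complex.I * (s * w / m : ℝ)) * Complex.exp (-(q : ℝ)) = Complex.exp z := by
    rw [hz, Complex.exp_add]
  have hwb : |w| ≤ c1 * c2 := hw.trans (by gcongr)
  have hLb : |s * w / m| ≤ c1 * c2 * A := by
    rw [div_eq_mul_inv, abs_mul, abs_mul, abs_of_pos hs, abs_of_pos hmi]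
    calc s * |w| * m⁻¹ = |w| * (s * m⁻¹) := by ring
      _ ≤ c1 * c2 * A := by gcongr
  have hzn : ‖z‖ ≤ |s * w / m| + |q| := by
    refine (norm_add_le _ _).trans ?_
    rw [norm_mul, Complex.norm_I, one_mul, norm_neg, Complex.norm_real, Complex.norm_real,
      Real.norm_eq_abs, Real.norm_eq_abs]
  have hzb : ‖z‖ ≤ c1 * c2 * A + c5 * A :=
    hzn.trans (add_le_add hLb (hqb.trans (by gcongr)))
  have hL2 : |s * w / m|^2 ≤ m⁻¹ * (A * c1^2 * c2 * W) := by
    rw [sq_abs]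
    have : (s * w / m)^2 = m⁻¹ * ((k * m⁻¹) * |w|^2) := by
      rw [sq_abs, ← hs2]; field_simp
    rw [this]
    refine mul_le_mul_of_nonneg_left ?_ hmi.le
    calc (k * m⁻¹) * |w|^2 ≤ A * (|w| * |w|) := by rw [sq]; gcongr
      _ ≤ A * ((c1 * c2) * (c1 * W)) := by gcongr
      _ = _ := by ring
  have hq2 : |q|^2 ≤ m⁻¹ * (c5^2 * A * (1 / s)) := by
    calc |q|^2 ≤ (c5 * m⁻¹)^2 := by gcongr
      _ = m⁻¹ * (c5^2 * m⁻¹) := by ring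
      _ ≤ m⁻¹ * (c5^2 * (A * (1 / s))) := by gcongr
      _ = _ := by ring
  have hz2 : ‖z‖^2 ≤ m⁻¹ * (2 * (A * c1^2 * c2 * W) + 2 * (c5^2 * A * (1/s))) := by
    calc ‖z‖^2 ≤ (|s * w / m| + |q|)^2 := by gcongr
      _ ≤ 2 * |s * w / m|^2 + 2 * |q|^2 := by nlinarith [sq_nonneg (|s * w / m| - |q|)]
      _ ≤ _ := by linarith
  have hE : ‖Complex.exp z - 1 - z‖ ≤ ‖z‖^2 * Real.exp ‖z‖ := by
    have := Complex.norm_exp_sub_sum_le_norm_mul_exp z 2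
    simpa [Finset.sum_range_succ, sub_sub] using this
  have key : 1 + (m⁻¹ : ℝ) * G - Complex.exp z =
      (m⁻¹ : ℝ) * (G - (Complex.I * (s * w : ℝ) - (Q / 2 : ℝ))) - (Complex.exp z - 1 - z)
      - ((m⁻¹ * (Γ * m⁻¹ / 2) : ℝ) : ℂ) := by
    have hm' : (m:ℂ) ≠ 0 := by exact_mod_cast hm.ne'
    rw [hz, hq]
    push_cast
    field_simp
    ring
  rw [ez, key]
  have n3 : ‖((m⁻¹ * (Γ * m⁻¹ / 2) : ℝ) : ℂ)‖ ≤ m⁻¹ * (c4 * A * (1 / s)) := by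
    rw [Complex.norm_real, Real.norm_eq_abs, abs_mul, abs_of_pos hmi]
    gcongr
    rw [abs_div, abs_mul, abs_of_pos hmi, abs_two]
    have : |Γ| * m⁻¹ ≤ c4 * (A * (1 / s)) := by gcongr
    nlinarith [show 0 ≤ |Γ| * m⁻¹ by positivity]
  have n2 : ‖Complex.exp z - 1 - z‖ ≤ m⁻¹ * (Real.exp (c1 * c2 * A + c5 * A) *
      (2 * (A * c1^2 * c2 * W) + 2 * (c5^2 * A * (1/s)))) := by
    refine hE.trans ?_
    calc ‖z‖^2 * Real.exp ‖z‖ ≤ (m⁻¹ * (2 * (A * c1^2 * c2 * W) + 2 * (c5^2 * A * (1/s))))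
          * Real.exp (c1 * c2 * A + c5 * A) := by
          apply mul_le_mul hz2 (Real.exp_le_exp.2 hzb) (Real.exp_pos _).le
          exact (sq_nonneg _).trans hz2
      _ = _ := by ring
  have n1 : ‖((m⁻¹ : ℝ):ℂ) * (G - (Complex.I * (s * w : ℝ) - (Q / 2 : ℝ)))‖ =
      m⁻¹ * ‖G - (Complex.I * (s * w : ℝ) - (Q / 2 : ℝ))‖ := by
    rw [norm_mul, Complex.norm_real, Real.norm_eq_abs, abs_of_pos hmi]
  refine (norm_sub_le _ _).trans ((add_le_add ((norm_sub_le _ _).trans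
    (add_le_add n1.le n2)) n3).trans ?_)
  rw [← mul_add, ← mul_add]
  refine mul_le_mul_of_nonneg_left ?_ hmi.le
  rw [add_assoc]
  refine add_le_add_right ?_ _
  set X := Real.exp (c1 * c2 * A + c5 * A)
  have hX : 0 < X := Real.exp_pos _
  have a1 : 0 ≤ 1 / s := by positivity
  have a2 : 0 ≤ X * (A * c1^2 * c2) * (1 / s) := by positivity
  have a3 : 0 ≤ X * (c5^2 * A) * W := by positivity
  have a4 : 0 ≤ c4 * A * W := by positivity
  nlinarith

/-- Oscillating test function. -/
def phiE (k : ℕ) (x : ℝ) : ℂ := Complex.exp (Complex.I * (x / √(k:ℝ) : ℝ))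

lemma phiE_norm (k : ℕ) (x : ℝ) : ‖phiE k x‖ = 1 := by
  rw [phiE, mul_comm, Complex.norm_exp_ofReal_mul_I]

lemma sum_dev (α : ℝ) (d : ℕ) (c : ℕ → ℝ) (R k : ℝ) (hk : 1 ≤ k) (b : ℕ → ℝ)
    (hc : ∀ r ∈ Finset.Icc 1 d, |c r| ≤ R) :
    |(∑ r ∈ Finset.Icc 1 d, c r * (b r - sibuya α r * k)) / k| ≤
      R * ∑ r ∈ Finset.Icc 1 d, |b r / k - sibuya α r| := by
  have hk0 : 0 < k := by linarith
  have : (∑ r ∈ Finset.Icc 1 d, c r * (b r - sibuya α r * k)) / k =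
      ∑ r ∈ Finset.Icc 1 d, c r * (b r / k - sibuya α r) := by
    rw [Finset.sum_div]
    exact Finset.sum_congr rfl fun r _ => by field_simp
  rw [this, Finset.mul_sum]
  refine (Finset.abs_sum_le_sum_abs _ _).trans (Finset.sum_le_sum fun r hr => ?_)
  rw [abs_mul]
  exact mul_le_mul_of_nonneg_right (hc r hr) (abs_nonneg _)

lemma gq_bound (α : ℝ) (d : ℕ) (h : ℕ → ℝ) (R : ℝ) (hR : 0 ≤ R)
    (hc : ∀ r ∈ Finset.Icc 1 d, |h r| ≤ R) :
    |gq α d h| ≤ R^2 * (∑ r ∈ Finset.Icc 1 d, |sibuya α r|) +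
      (R * ∑ r ∈ Finset.Icc 1 d, |sibuya α r|)^2 := by
  unfold gq
  refine (abs_sub _ _).trans (add_le_add ?_ ?_)
  · refine (Finset.abs_sum_le_sum_abs _ _).trans ?_
    rw [Finset.mul_sum]
    refine Finset.sum_le_sum fun r hr => ?_
    rw [abs_mul, abs_pow, mul_comm]
    have := hc r hr
    gcongr
  · rw [abs_pow]
    gcongr
    refine (Finset.abs_sum_le_sum_abs _ _).trans ?_
    rw [Finset.mul_sum]
    refine Finset.sum_le_sum fun r hr => ?_
    rw [abs_mul]
    exact mul_le_mul_of_nonneg_right (hc r hr) (abs_nonneg _)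

lemma LL_bound (α : ℝ) (hα0 : 0 < α) (hα1 : α < 1) (d : ℕ) (h : ℕ → ℝ) (R : ℝ)
    (hc : ∀ r, |h r| ≤ R) (r : ℕ) (hr : r ∈ Finset.Icc 1 d) : |LL α d h r| ≤ R * (2 * d + 1) := by
  obtain ⟨h1, h2⟩ := Finset.mem_Icc.1 hr
  have h1' : (1:ℝ) ≤ r := by exact_mod_cast h1
  have h2' : (r:ℝ) ≤ d := by exact_mod_cast h2
  have hR : 0 ≤ R := (abs_nonneg _).trans (hc 0)
  rw [LL, if_pos ⟨h1, h2⟩]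
  refine (abs_sub _ _).trans ?_
  rw [abs_mul, abs_mul, abs_of_nonneg (show (0:ℝ) ≤ r - α by linarith),
    abs_of_pos (show 0 < α / 2 by linarith)]
  have a1 : |h (r+1) - h r| ≤ 2 * R := (abs_sub _ _).trans (by linarith [hc r, hc (r+1)])
  have a2 : ((r:ℝ) - α) * |h (r+1) - h r| ≤ d * (2 * R) := by
    gcongr; linarith
  have a3 : α / 2 * |h r| ≤ 1 * R := by
    gcongr
    · linarith
    · exact hc r
  linarith

set_option maxHeartbeats 1000000 in
lemma G_est (α θ : ℝ) (hα0 : 0 < α) (hα1 : α < 1) (d : ℕ) (R : ℝ) (hR : 0 ≤ R) :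
    ∃ C, 0 ≤ C ∧ ∀ h : ℕ → ℝ, (∀ r, |h r| ≤ R) → h (d+1) = 0 → ∀ (k : ℝ) (b : ℕ → ℝ),
    1 ≤ k → (∀ r, 1 ≤ r → 0 ≤ b r) → (∀ r, 1 ≤ r → b r ≤ k) → ∀ x,
    x = ∑ r ∈ Finset.Icc 1 d, h r * (b r - sibuya α r * k) →
    ‖(((α * k + θ : ℝ):ℂ) * (Complex.exp (Complex.I * ((x + ff1 α d h) / √(k+1) - x / √k : ℝ)) - 1)
      + ∑ r ∈ Finset.Icc 1 d, ((((r:ℝ) - α) * b r : ℝ) : ℂ) *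
        (Complex.exp (Complex.I * ((h (r+1) - h r) / √k : ℝ)) - 1))
      - (Complex.I * (√k * ((∑ r ∈ Finset.Icc 1 d, LL α d h r * (b r - sibuya α r * k)) / k) : ℝ)
        - (QQ α d h / 2 : ℝ))‖ ≤
     C * (1 / √k + ∑ r ∈ Finset.Icc 1 d, |b r / k - sibuya α r|) := by
  set P := ∑ r ∈ Finset.Icc 1 d, |sibuya α r| with hP
  have hP0 : 0 ≤ P := Finset.sum_nonneg fun _ _ => abs_nonneg _
  set M := R * (2 + d + P) with hM
  have hM0 : 0 ≤ M := by positivity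
  set C1 := ((α + |θ|) * (64 * M^3 * Real.exp (4 * M)) + (2 * α * M + 4 * |θ| * M) +
      (6 * α * M^2 + 8 * |θ| * M^2) + α * M) with hC1
  have hC10 : 0 ≤ C1 := by positivity
  set C2 := (d * M^3 * Real.exp M + d * M^2) with hC2
  have hC20 : 0 ≤ C2 := by positivity
  refine ⟨C1 * (1 + R) + d * C2, by positivity, ?_⟩
  intro h hh hd1 k b hk hb0 hb x hx
  have hk0 : 0 < k := by linarith
  have hs : 0 < √k := Real.sqrt_pos.2 (by linarith)
  have hs2 : √k * √k = k := Real.mul_self_sqrt (by linarith)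
  set W := ∑ r ∈ Finset.Icc 1 d, |b r / k - sibuya α r| with hW
  have hW0 : 0 ≤ W := Finset.sum_nonneg fun _ _ => abs_nonneg _
  have hWr : ∀ r ∈ Finset.Icc 1 d, |b r / k - sibuya α r| ≤ W := fun r hr =>
    Finset.single_le_sum (f := fun r => |b r / k - sibuya α r|) (fun _ _ => abs_nonneg _) hr
  have hWb : W ≤ d + P := by
    have : W ≤ ∑ r ∈ Finset.Icc 1 d, (1 + |sibuya α r|) := by
      refine Finset.sum_le_sum fun r hr => ?_
      have h1 := (Finset.mem_Icc.1 hr).1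
      refine (abs_sub _ _).trans (add_le_add ?_ le_rfl)
      rw [abs_of_nonneg (div_nonneg (hb0 r h1) hk0.le), div_le_one hk0]
      exact hb r h1
    simpa [Finset.sum_add_distrib] using this
  set w := x / k with hw
  have hxw : x = k * w := by rw [hw]; field_simp
  have hwW : |w| ≤ R * W := by
    rw [hw, hx]; exact sum_dev α d h R k hk b fun r _ => hh r
  have hwM : |w| ≤ M := by
    refine hwW.trans (mul_le_mul_of_nonneg_left ?_ hR)
    linarith
  have hf : |ff1 α d h| ≤ M := by
    unfold ff1
    refine (abs_sub _ _).trans ?_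
    have : |∑ r ∈ Finset.Icc 1 d, h r * sibuya α r| ≤ R * P := by
      refine (Finset.abs_sum_le_sum_abs _ _).trans ?_
      rw [hP, Finset.mul_sum]
      refine Finset.sum_le_sum fun r hr => ?_
      rw [abs_mul]
      exact mul_le_mul_of_nonneg_right (hh r) (abs_nonneg _)
    have h2 := hh 1
    have h3 : (0:ℝ) ≤ d := Nat.cast_nonneg _
    rw [hM]; nlinarith
  have E1 := new_est α θ M hα0 hM0 k (ff1 α d h) w hk hf hwM
  rw [← hC1, ← hxw] at E1
  have E1' : C1 * (1 / √k + |w|) ≤ C1 * (1 + R) * (1 / √k + W) := by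
    rw [mul_assoc]
    refine mul_le_mul_of_nonneg_left ?_ hC10
    have c0 : 0 ≤ 1 / √k := by positivity
    calc 1 / √k + |w| ≤ 1 / √k + R * W := by gcongr
      _ ≤ (1 / √k + R * W) + (W + R * (1 / √k)) := le_add_of_nonneg_right (by positivity)
      _ = (1 + R) * (1 / √k + W) := by ring
  have E2 : ∀ r ∈ Finset.Icc 1 d, ‖((((r:ℝ) - α) * b r : ℝ):ℂ) *
      (Complex.exp (Complex.I * ((h (r+1) - h r) / √k : ℝ)) - 1)
      - (Complex.I * (((r:ℝ) - α) * b r * (h (r+1) - h r) / √k : ℝ)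
        - (((r:ℝ) - α) * sibuya α r * (h (r+1) - h r)^2 / 2 : ℝ))‖ ≤
      C2 * (1 / √k + W) := by
    intro r hr
    obtain ⟨h1, h2⟩ := Finset.mem_Icc.1 hr
    have h1' : (1:ℝ) ≤ r := by exact_mod_cast h1
    have h2' : (r:ℝ) ≤ d := by exact_mod_cast h2
    have hg : |h (r+1) - h r| ≤ M := by
      refine (abs_sub _ _).trans ?_
      have h3 := hh r
      have h4 := hh (r+1)
      have h5 : 0 ≤ R * (d + P) := by positivity
      rw [hM]; nlinarith
    refine (grow_est ((r:ℝ) - α) M (by linarith) hM0 k (b r) (sibuya α r) (h (r+1) - h r) hk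
      (hb0 r h1) (hb r h1) hg).trans ?_
    have h6 : (r:ℝ) - α ≤ d := by linarith
    have h7 := hWr r hr
    rw [hC2]
    gcongr
  have t1 := sib_tel α d h
  rw [hd1] at t1
  have eS : ∑ r ∈ Finset.Icc 1 d, h r * sibuya α r = ∑ r ∈ Finset.Icc 1 d, sibuya α r * h r :=
    Finset.sum_congr rfl fun r _ => mul_comm _ _
  have lin : √k * ((∑ r ∈ Finset.Icc 1 d, LL α d h r * (b r - sibuya α r * k)) / k) =
      (α * k * ff1 α d h - α * k * w / 2) / √k +
      ∑ r ∈ Finset.Icc 1 d, ((r:ℝ) - α) * b r * (h (r+1) - h r) / √k := by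
    have e1 : ∑ r ∈ Finset.Icc 1 d, LL α d h r * (b r - sibuya α r * k) =
      ∑ r ∈ Finset.Icc 1 d, (((r:ℝ) - α) * b r * (h (r+1) - h r)) -
        k * (∑ r ∈ Finset.Icc 1 d, sibuya α r * (((r:ℝ) - α) * (h (r+1) - h r))) -
        α / 2 * x := by
      rw [hx, Finset.mul_sum, Finset.mul_sum, ← Finset.sum_sub_distrib, ← Finset.sum_sub_distrib]
      refine Finset.sum_congr rfl fun r hr => ?_
      rw [LL, if_pos (Finset.mem_Icc.1 hr)]; ring
    have e3 : ∀ y, √k * (y / k) = y / √k := by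
      intro y
      rw [eq_div_iff hs.ne']
      calc √k * (y / k) * √k = (√k * √k) * (y / k) := by ring
        _ = y := by rw [hs2]; field_simp
    rw [e3, e1, t1, ← Finset.sum_div, ff1, eS, hxw]
    ring
  have quad : QQ α d h / 2 = α * ff1 α d h ^2 / 2 +
      ∑ r ∈ Finset.Icc 1 d, ((r:ℝ) - α) * sibuya α r * (h (r+1) - h r)^2 / 2 := by
    rw [QQ, ← Finset.sum_div]; ring
  have key : ∀ (a a' q q' : ℂ) (u v t : ℕ → ℂ), (a + ∑ r ∈ Finset.Icc 1 d, u r) -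
      (Complex.I * (a' + ∑ r ∈ Finset.Icc 1 d, v r) - (q + ∑ r ∈ Finset.Icc 1 d, t r)) =
      (a - (Complex.I * a' - q)) + ∑ r ∈ Finset.Icc 1 d, (u r - (Complex.I * v r - t r)) := by
    intro a a' q q' u v t
    rw [Finset.sum_sub_distrib, Finset.sum_sub_distrib, ← Finset.mul_sum]; ring
  rw [lin, quad, Complex.ofReal_add ((α * k * ff1 α d h - α * k * w / 2) / √k),
    Complex.ofReal_add (α * ff1 α d h ^2 / 2), Complex.ofReal_sum, Complex.ofReal_sum,
    key _ _ _ 0]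
  refine (norm_add_le _ _).trans ?_
  refine (add_le_add (E1.trans E1') ((norm_sum_le _ _).trans (Finset.sum_le_sum E2))).trans ?_
  rw [Finset.sum_const, Nat.card_Icc, nsmul_eq_mul]
  simp only [Nat.add_sub_cancel]
  apply le_of_eq; ring

set_option maxHeartbeats 1000000 in
lemma step_est (α θ : ℝ) (hα0 : 0 < α) (hα1 : α < 1) (d : ℕ) (R : ℝ) (hR : 0 ≤ R) (A : ℝ)
    (hA : 0 ≤ A) :
    ∃ C, 0 ≤ C ∧ ∀ h : ℕ → ℝ, (∀ r, |h r| ≤ R) → h (d+1) = 0 → ∀ (m : ℝ) (k : ℕ) (b : ℕ → ℕ),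
    0 < m → 1 ≤ k → (k:ℝ) ≤ A * m → (∀ r, 1 ≤ r → b r ≤ k) → ∀ x y,
    x = ∑ r ∈ Finset.Icc 1 d, h r * ((b r : ℝ) - sibuya α r * (k:ℝ)) →
    y = ∑ r ∈ Finset.Icc 1 d, (h r + m⁻¹ * LL α d h r) * ((b r : ℝ) - sibuya α r * (k:ℝ)) →
    ‖phiE k x + m⁻¹ • genE α θ phiE d h k b x - phiE k y *
      Complex.exp (-((gq α d h - gq α d (fun r => h r + m⁻¹ * LL α d h r)) / 2 : ℝ))‖ ≤
     m⁻¹ * (C * (1 / √(k:ℝ) + ∑ r ∈ Finset.Icc 1 d, |(b r : ℝ) / (k:ℝ) - sibuya α r|)) := by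
  obtain ⟨C0, hC0, HG⟩ := G_est α θ hα0 hα1 d R hR
  set P := ∑ r ∈ Finset.Icc 1 d, |sibuya α r| with hP
  have hP0 : 0 ≤ P := Finset.sum_nonneg fun _ _ => abs_nonneg _
  set R2 := R * (2 * d + 1) with hR2
  have hR20 : 0 ≤ R2 := by positivity
  set c4 := R2^2 * P + (R2 * P)^2 with hc4
  have hc40 : 0 ≤ c4 := by positivity
  set M := R * (2 + P) with hM
  have hM0 : 0 ≤ M := by positivity
  set c3 := M^2 + d * P * M^2 with hc3
  have hc30 : 0 ≤ c3 := by positivity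
  refine ⟨C0 + (c4 * A + Real.exp (R2 * (d + P) * A + (c3 + c4 * A) * A) *
        (2 * A * R2^2 * (d + P) + 2 * (c3 + c4 * A)^2 * A)), by positivity, ?_⟩
  intro h hh hd1 m k b hm hk hkm hb x y hx hy
  have hk1 : (1:ℝ) ≤ k := by exact_mod_cast hk
  have hk0 : (0:ℝ) < k := by linarith
  have hs : 0 < √(k:ℝ) := Real.sqrt_pos.2 (by linarith)
  have hs2 : √(k:ℝ) * √(k:ℝ) = k := Real.mul_self_sqrt (by linarith)
  have hb' : ∀ r, 1 ≤ r → (b r : ℝ) ≤ k := fun r hr => by exact_mod_cast hb r hr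
  have HG1 := HG h hh hd1 k (fun r => (b r : ℝ)) hk1 (fun r _ => Nat.cast_nonneg _) hb' x hx
  set G := (((α * k + θ : ℝ):ℂ) * (Complex.exp (Complex.I * ((x + ff1 α d h) / √((k:ℝ)+1) - x / √(k:ℝ) : ℝ)) - 1)
      + ∑ r ∈ Finset.Icc 1 d, ((((r:ℝ) - α) * (b r : ℝ) : ℝ) : ℂ) *
        (Complex.exp (Complex.I * ((h (r+1) - h r) / √(k:ℝ) : ℝ)) - 1)) with hG
  set W := ∑ r ∈ Finset.Icc 1 d, |(b r : ℝ) / (k:ℝ) - sibuya α r| with hW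
  have hW0 : 0 ≤ W := Finset.sum_nonneg fun _ _ => abs_nonneg _
  have hWb : W ≤ d + P := by
    have : W ≤ ∑ r ∈ Finset.Icc 1 d, (1 + |sibuya α r|) := by
      refine Finset.sum_le_sum fun r hr => ?_
      have h1 := (Finset.mem_Icc.1 hr).1
      refine (abs_sub _ _).trans (add_le_add ?_ le_rfl)
      rw [abs_of_nonneg (div_nonneg (Nat.cast_nonneg _) hk0.le), div_le_one hk0]
      exact hb' r h1
    simpa [Finset.sum_add_distrib] using this
  set w := (∑ r ∈ Finset.Icc 1 d, LL α d h r * ((b r : ℝ) - sibuya α r * (k:ℝ))) / (k:ℝ) with hw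
  have hwW : |w| ≤ R2 * W :=
    sum_dev α d (LL α d h) R2 k hk1 (fun r => (b r:ℝ)) fun r hr => LL_bound α hα0 hα1 d h R hh r hr
  have hΓ : |gq α d (LL α d h)| ≤ c4 :=
    gq_bound α d _ R2 hR20 fun r hr => LL_bound α hα0 hα1 d h R hh r hr
  have hf : |ff1 α d h| ≤ M := by
    unfold ff1
    refine (abs_sub _ _).trans ?_
    have : |∑ r ∈ Finset.Icc 1 d, h r * sibuya α r| ≤ R * P := by
      refine (Finset.abs_sum_le_sum_abs _ _).trans ?_
      rw [hP, Finset.mul_sum]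
      refine Finset.sum_le_sum fun r hr => ?_
      rw [abs_mul]
      exact mul_le_mul_of_nonneg_right (hh r) (abs_nonneg _)
    have h2 := hh 1
    rw [hM]; nlinarith
  have hQ : |QQ α d h| ≤ c3 := by
    unfold QQ
    refine (abs_add_le _ _).trans (add_le_add ?_ ?_)
    · rw [abs_mul, abs_pow, abs_of_pos hα0]
      calc α * |ff1 α d h|^2 ≤ 1 * M^2 := by gcongr
        _ = M^2 := one_mul _
    · refine (Finset.abs_sum_le_sum_abs _ _).trans ?_
      rw [hP, Finset.mul_sum, Finset.sum_mul]
      refine Finset.sum_le_sum fun r hr => ?_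
      obtain ⟨h1, h2⟩ := Finset.mem_Icc.1 hr
      have h1' : (1:ℝ) ≤ r := by exact_mod_cast h1
      have h2' : (r:ℝ) ≤ d := by exact_mod_cast h2
      rw [abs_mul, abs_mul, abs_pow, abs_of_nonneg (show (0:ℝ) ≤ r - α by linarith)]
      have hg : |h (r+1) - h r| ≤ M := by
        refine (abs_sub _ _).trans ?_
        have h3 := hh r
        have h4 := hh (r+1)
        have h5 : 0 ≤ R * P := by positivity
        rw [hM]; nlinarith
      gcongr
      linarith
  have HB := expB A R2 (d + P) c3 c4 hA hR20 (by positivity) hc30 hc40 m k w W (QQ α d h)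
    (gq α d (LL α d h)) G hm hk1 hkm hwW hW0 hWb hQ hΓ
  have eq : (gq α d h - gq α d (fun r => h r + m⁻¹ * LL α d h r)) / 2 =
      QQ α d h / (2 * m) - gq α d (LL α d h) / (2 * m^2) := by
    rw [gq_LL α d h hd1]; field_simp; ring
  have ephi : ∀ u v : ℝ, Complex.exp (Complex.I * ((u + v : ℝ):ℂ)) =
      Complex.exp (Complex.I * u) * Complex.exp (Complex.I * v) := by
    intro u v; rw [← Complex.exp_add]; push_cast; ring_nf
  have ey : phiE k y = phiE k x * Complex.exp (Complex.I * (√(k:ℝ) * w / m : ℝ)) := by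
    rw [phiE, phiE, ← ephi]
    congr 3
    have : y = x + m⁻¹ * (k * w) := by
      have : (k:ℝ) * w = ∑ r ∈ Finset.Icc 1 d, LL α d h r * ((b r : ℝ) - sibuya α r * (k:ℝ)) := by
        rw [hw]; field_simp
      rw [this, hy, hx, Finset.mul_sum, ← Finset.sum_add_distrib]
      exact Finset.sum_congr rfl fun r _ => by ring
    rw [this, add_div]
    congr 1
    rw [div_eq_iff hs.ne']
    calc m⁻¹ * (k * w) = (√(k:ℝ) * √(k:ℝ)) * w / m := by rw [hs2]; ring
      _ = _ := by ring
  have eG : genE α θ phiE d h k b x = phiE k x * G := by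
    unfold genE
    have e1 : phiE (k+1) (x + ff1 α d h) = phiE k x *
        Complex.exp (Complex.I * ((x + ff1 α d h) / √((k:ℝ)+1) - x / √(k:ℝ) : ℝ)) := by
      rw [phiE, phiE, ← ephi]; push_cast; ring_nf
    have e2 : ∀ g, phiE k (x + g) = phiE k x * Complex.exp (Complex.I * (g / √(k:ℝ) : ℝ)) := by
      intro g
      rw [phiE, phiE, ← ephi, add_div]
    simp only [e1, e2, Complex.real_smul]
    rw [hG, mul_add, Finset.mul_sum]
    congr 1
    · ring
    · exact Finset.sum_congr rfl fun r _ => by ring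
  rw [eq, ey, eG, Complex.real_smul]
  have fin : phiE k x + ((m⁻¹:ℝ):ℂ) * (phiE k x * G) - phiE k x *
      Complex.exp (Complex.I * (√(k:ℝ) * w / m : ℝ)) *
      Complex.exp (-(QQ α d h / (2 * m) - gq α d (LL α d h) / (2 * m^2) : ℝ)) = phiE k x *
      (1 + (m⁻¹ : ℝ) * G - Complex.exp (Complex.I * (√(k:ℝ) * w / m : ℝ)) *
      Complex.exp (-(QQ α d h / (2 * m) - gq α d (LL α d h) / (2 * m^2) : ℝ))) := by ring
  rw [fin, norm_mul, phiE_norm, one_mul]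
  refine HB.trans (mul_le_mul_of_nonneg_left ?_ (inv_pos.2 hm).le)
  rw [add_mul C0]
  exact add_le_add HG1 le_rfl

section EP
variable {α θ : ℝ} {Ω : Type*} {mΩ : MeasurableSpace Ω}
    {μ : Measure Ω} {F : Filtration ℕ mΩ} {K : ℕ → Ω → ℕ} {B : ℕ → ℕ → Ω → ℕ}

/-- Normalized characteristic function. -/
def DD (α : ℝ) {Ω : Type*} {mΩ : MeasurableSpace Ω} (μ : Measure Ω) (K : ℕ → Ω → ℕ)
    (B : ℕ → ℕ → Ω → ℕ) (d n : ℕ) (h : ℕ → ℝ) : ℂ :=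
  (∫ ω, phiE (K n ω) (XX α K B d h n ω) ∂μ) * Complex.exp ((gq α d h / 2 : ℝ))

/-- One step of the backward recursion. -/
def hst (α θ : ℝ) (d n : ℕ) (h : ℕ → ℝ) (r : ℕ) : ℝ := h r + ((n:ℝ)+θ)⁻¹ * LL α d h r

lemma phiE_cont (k : ℕ) : Continuous (phiE k) := by unfold phiE; fun_prop

lemma n_le_A (hα1 : α < 1) (hθ : 0 < α + θ) (n : ℕ) (hn : 1 ≤ n) :
    (n:ℝ) ≤ (1 + 1 / (1 + θ)) * ((n:ℝ) + θ) := by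
  have h1 : (1:ℝ) ≤ n := by exact_mod_cast hn
  have h2 : 0 < 1 + θ := by linarith
  have h3 : (1 + 1 / (1 + θ)) * ((n:ℝ) + θ) = ((2 + θ) * (n + θ)) / (1 + θ) := by field_simp; ring
  rw [h3, le_div_iff₀ h2]
  rcases le_total 0 θ with h | h <;> nlinarith

lemma step_D (hEP : IsEwensPitman α θ μ F K B) (hα0 : 0 < α) (hα1 : α < 1) (hθ : 0 < α + θ)
    (d : ℕ) (hd : 1 ≤ d) (R : ℝ) (hR : 0 ≤ R) :
    ∃ C, 0 ≤ C ∧ ∀ h : ℕ → ℝ, (∀ r, |h r| ≤ R) → h (d+1) = 0 → ∀ n, 1 ≤ n →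
      ‖DD α μ K B d (n+1) h - DD α μ K B d n (hst α θ d n h)‖ ≤
        C * (epsE α μ K B d n * ((n:ℝ)+θ)⁻¹) := by
  have := hEP.prob
  obtain ⟨C, hC, H⟩ := step_est α θ hα0 hα1 d R hR (1 + 1 / (1 + θ))
    (by have : 0 < 1 + θ := by linarith
        positivity)
  set P := ∑ r ∈ Finset.Icc 1 d, |sibuya α r| with hP
  set E0 := Real.exp ((R^2 * P + (R * P)^2) / 2) with hE0
  refine ⟨E0 * C, by positivity, ?_⟩
  intro h hh hd1 n hn
  have hm := n_theta_pos hα1 hθ n hn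
  obtain ⟨i1, i2, e⟩ := EP_step hEP hα1 hθ phiE phiE_cont d hd h hd1 n hn
  have hd1' : hst α θ d n h (d+1) = 0 := by simp [hst, LL, hd1]
  obtain ⟨j1, -, -⟩ := EP_step hEP hα1 hθ phiE phiE_cont d hd _ hd1' n hn
  have k1 : DD α μ K B d (n+1) h - DD α μ K B d n (hst α θ d n h) =
      (∫ ω, (phiE (K n ω) (XX α K B d h n ω) + ((n:ℝ)+θ)⁻¹ •
        genE α θ phiE d h (K n ω) (fun r => B r n ω) (XX α K B d h n ω)
        - phiE (K n ω) (XX α K B d (hst α θ d n h) n ω) *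
      Complex.exp (-((gq α d h - gq α d (hst α θ d n h)) / 2 : ℝ))) ∂μ) *
      Complex.exp ((gq α d h / 2 : ℝ)) := by
    have i3 : Integrable (fun ω => phiE (K n ω) (XX α K B d h n ω) + ((n:ℝ)+θ)⁻¹ •
        genE α θ phiE d h (K n ω) (fun r => B r n ω) (XX α K B d h n ω)) μ := i1.add i2
    rw [integral_sub i3 (j1.mul_const _), integral_add i1 i2, ← e, integral_mul_const,
      DD, DD, sub_mul, mul_assoc, ← Complex.exp_add]
    congr 3
    push_cast; ring_nf
  rw [k1, norm_mul]
  have b1 : ‖Complex.exp ((gq α d h / 2 : ℝ))‖ ≤ E0 := by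
    rw [Complex.norm_exp, Complex.ofReal_re, hE0]
    apply Real.exp_le_exp.2
    have := (le_abs_self _).trans (gq_bound α d h R hR fun r _ => hh r)
    linarith
  have b2 := norm_integral_le_of_norm_le
    (((epsE_int hEP hα1 hθ d n hn).const_mul C).const_mul ((n:ℝ)+θ)⁻¹) (f := fun ω =>
      (phiE (K n ω) (XX α K B d h n ω) + ((n:ℝ)+θ)⁻¹ •
        genE α θ phiE d h (K n ω) (fun r => B r n ω) (XX α K B d h n ω)
        - phiE (K n ω) (XX α K B d (hst α θ d n h) n ω) *
      Complex.exp (-((gq α d h - gq α d (hst α θ d n h)) / 2 : ℝ)))) (by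
    filter_upwards [EP_basic hEP n hn] with ω hω
    refine H h hh hd1 _ (K n ω) (fun r => B r n ω) hm hω.1 ?_ hω.2.2 _ _ rfl rfl
    have : (K n ω : ℝ) ≤ n := by exact_mod_cast hω.2.1
    exact this.trans (n_le_A hα1 hθ n hn))
  rw [integral_const_mul, integral_const_mul] at b2
  refine (mul_le_mul b2 b1 (norm_nonneg _) ((norm_nonneg _).trans b2)).trans (le_of_eq ?_)
  unfold epsE
  ring

lemma hst_bound (hα0 : 0 < α) (hα1 : α < 1) (d n : ℕ) (hnd : (d:ℝ) ≤ n + θ) (hd : 1 ≤ d)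
    (h : ℕ → ℝ) (R : ℝ)
    (hh : ∀ r, |h r| ≤ R) (hz : ∀ r, r ∉ Finset.Icc 1 d → h r = 0) :
    (∀ r, |hst α θ d n h r| ≤ R * (1 - α / 2 * ((n:ℝ)+θ)⁻¹)) ∧
    ∀ r, r ∉ Finset.Icc 1 d → hst α θ d n h r = 0 := by
  have hd' : (1:ℝ) ≤ d := by exact_mod_cast hd
  have hm : 0 < (n:ℝ) + θ := by linarith
  set m := (n:ℝ) + θ with hmdef
  have hR : 0 ≤ R := (abs_nonneg _).trans (hh 0)
  have hmi : 0 < m⁻¹ := inv_pos.2 hm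
  have hdm : d * m⁻¹ ≤ 1 := by rw [← div_eq_mul_inv, div_le_one hm]; exact hnd
  have hz' : ∀ r, r ∉ Finset.Icc 1 d → hst α θ d n h r = 0 := by
    intro r hr
    rw [hst, hz r hr, LL, if_neg (by simpa using hr)]; simp
  refine ⟨fun r => ?_, hz'⟩
  by_cases hr : r ∈ Finset.Icc 1 d
  · obtain ⟨h1, h2⟩ := Finset.mem_Icc.1 hr
    have h1' : (1:ℝ) ≤ r := by exact_mod_cast h1
    have h2' : (r:ℝ) ≤ d := by exact_mod_cast h2
    have e : hst α θ d n h r = (1 - (r - α / 2) * m⁻¹) * h r + ((r - α) * m⁻¹) * h (r+1) := by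
      rw [hst, LL, if_pos ⟨h1, h2⟩]; ring
    have a1 : 0 ≤ 1 - (r - α / 2) * m⁻¹ := by
      have : (r - α / 2) * m⁻¹ ≤ d * m⁻¹ := by gcongr; linarith
      linarith
    have a2 : 0 ≤ (r - α) * m⁻¹ := mul_nonneg (by linarith) hmi.le
    rw [e]
    refine (abs_add_le _ _).trans ?_
    rw [abs_mul, abs_mul, abs_of_nonneg a1, abs_of_nonneg a2]
    calc _ ≤ (1 - (r - α / 2) * m⁻¹) * R + ((r - α) * m⁻¹) * R := by
          gcongr
          · exact hh _
          · exact hh _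
      _ = _ := by ring
  · rw [hz' r hr, abs_zero]
    have : m⁻¹ ≤ d * m⁻¹ := by nlinarith
    apply mul_nonneg hR
    nlinarith

lemma iter_D (hEP : IsEwensPitman α θ μ F K B) (hα0 : 0 < α) (hα1 : α < 1) (hθ : 0 < α + θ)
    (d : ℕ) (hd : 1 ≤ d) (R : ℝ) (hR : 0 ≤ R) :
    ∃ C, 0 ≤ C ∧ ∀ n : ℕ, 1 ≤ n → (d:ℝ) ≤ n + θ → ∀ (j : ℕ) (h : ℕ → ℝ) (ρ : ℝ), ρ ≤ R →
      (∀ r, |h r| ≤ ρ) → (∀ r, r ∉ Finset.Icc 1 d → h r = 0) →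
      ∃ h' : ℕ → ℝ, (∀ r, |h' r| ≤ ρ * ∏ i ∈ Finset.range j, (1 - α / 2 * (((n+i:ℕ):ℝ)+θ)⁻¹)) ∧
        (∀ r, r ∉ Finset.Icc 1 d → h' r = 0) ∧
      ‖DD α μ K B d (n+j) h - DD α μ K B d n h'‖ ≤
        C * ∑ i ∈ Finset.range j, (epsE α μ K B d (n+i) * (((n+i:ℕ):ℝ)+θ)⁻¹) := by
  obtain ⟨C, hC, H⟩ := step_D hEP hα0 hα1 hθ d hd R hR
  refine ⟨C, hC, fun n hn hnd j => ?_⟩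
  induction j with
  | zero =>
    intro h ρ hρ hh hz
    exact ⟨h, by simpa using hh, hz, by simp⟩
  | succ j ih =>
    intro h ρ hρ hh hz
    have hρ0 : 0 ≤ ρ := (abs_nonneg _).trans (hh 0)
    have hnd' : (d:ℝ) ≤ ((n+j:ℕ):ℝ) + θ := by
      push_cast
      have : (0:ℝ) ≤ j := Nat.cast_nonneg _
      linarith
    have hm := n_theta_pos hα1 hθ (n+j) (by omega)
    obtain ⟨q1, q2⟩ := hst_bound (θ := θ) hα0 hα1 d (n+j) hnd' hd h ρ hh hz
    have hmi : 0 < (((n+j:ℕ):ℝ)+θ)⁻¹ := inv_pos.2 hm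
    have hle : ρ * (1 - α / 2 * (((n+j:ℕ):ℝ)+θ)⁻¹) ≤ ρ := by
      apply mul_le_of_le_one_right hρ0
      have : 0 ≤ α / 2 * (((n+j:ℕ):ℝ)+θ)⁻¹ := by positivity
      linarith
    obtain ⟨h', r1, r2, r3⟩ := ih _ _ (hle.trans hρ) q1 q2
    refine ⟨h', fun r => ?_, r2, ?_⟩
    · rw [Finset.prod_range_succ]
      refine (r1 r).trans (le_of_eq (by ring))
    · rw [Finset.sum_range_succ, mul_add]
      have s := H h (fun r => (hh r).trans hρ) (hz _ (by simp)) (n+j) (by omega)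
      calc _ = ‖(DD α μ K B d (n+(j+1)) h - DD α μ K B d (n+j) (hst α θ d (n+j) h)) +
            (DD α μ K B d (n+j) (hst α θ d (n+j) h) - DD α μ K B d n h')‖ := by congr 1; ring
        _ ≤ _ := (norm_add_le _ _).trans (by rw [add_comm]; exact add_le_add r3 s)

lemma prod_zero (hα0 : 0 < α) (hα1 : α < 1) (hθ : 0 < α + θ) (n : ℕ) (hn : 1 ≤ n)
    (d : ℕ) (hd : 1 ≤ d) (hnd : (d:ℝ) ≤ n + θ) :
    Tendsto (fun j => ∏ i ∈ Finset.range j, (1 - α / 2 * (((n+i:ℕ):ℝ)+θ)⁻¹)) atTop (𝓝 0) := by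
  have hd' : (1:ℝ) ≤ d := by exact_mod_cast hd
  have hm : ∀ i : ℕ, 1 ≤ ((n+i:ℕ):ℝ)+θ := fun i => by
    push_cast
    have : (0:ℝ) ≤ i := Nat.cast_nonneg _
    linarith
  have hnn : ∀ i : ℕ, 0 ≤ 1 - α / 2 * (((n+i:ℕ):ℝ)+θ)⁻¹ := fun i => by
    have h1 : (((n+i:ℕ):ℝ)+θ)⁻¹ ≤ 1 := inv_le_one_of_one_le₀ (hm i)
    have h2 : 0 < (((n+i:ℕ):ℝ)+θ)⁻¹ := inv_pos.2 (by linarith [hm i])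
    nlinarith
  set c := (n:ℝ) + θ with hc
  have hc0 : 1 ≤ c := by linarith
  have hle : ∀ j, ∏ i ∈ Finset.range j, (1 - α / 2 * (((n+i:ℕ):ℝ)+θ)⁻¹) ≤
      Real.exp (- (α / 2 * c⁻¹ * ∑ i ∈ Finset.range j, (1 / ((i:ℝ)+1)))) := by
    intro j
    rw [Finset.mul_sum, ← Finset.sum_neg_distrib, Real.exp_sum]
    refine Finset.prod_le_prod (fun i _ => hnn i) fun i _ => ?_
    have := Real.add_one_le_exp (-(α / 2 * (((n+i:ℕ):ℝ)+θ)⁻¹))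
    refine le_trans (by linarith) (this.trans (Real.exp_le_exp.2 ?_))
    rw [neg_le_neg_iff, mul_assoc]
    gcongr
    rw [one_div, ← mul_inv]
    apply inv_anti₀ (by linarith [hm i])
    push_cast
    have : (0:ℝ) ≤ i := Nat.cast_nonneg _
    nlinarith
  refine squeeze_zero (fun j => Finset.prod_nonneg fun i _ => hnn i) hle ?_
  refine Real.tendsto_exp_neg_atTop_nhds_zero.comp ?_
  exact Real.tendsto_sum_range_one_div_nat_succ_atTop.const_mul_atTop (by positivity)

lemma DD_near (hEP : IsEwensPitman α θ μ F K B) (hα1 : α < 1) (hθ : 0 < α + θ)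
    (d : ℕ) (hd : 1 ≤ d) (n : ℕ) (hn : 1 ≤ n) (h : ℕ → ℝ) (ρ : ℝ) 
    (hh : ∀ r, |h r| ≤ ρ) (hz : h (d+1) = 0) :
    ‖DD α μ K B d n h - 1‖ ≤
     (ρ * ((∑ r ∈ Finset.Icc 1 d, (1 + |sibuya α r|)) * n)) *
      Real.exp ((ρ^2 * (∑ r ∈ Finset.Icc 1 d, |sibuya α r|) +
      (ρ * ∑ r ∈ Finset.Icc 1 d, |sibuya α r|)^2)/2) +
      (Real.exp ((ρ^2 * (∑ r ∈ Finset.Icc 1 d, |sibuya α r|) +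
      (ρ * ∑ r ∈ Finset.Icc 1 d, |sibuya α r|)^2)/2) - 1) := by
  have := hEP.prob
  have hρ : 0 ≤ ρ := (abs_nonneg _).trans (hh 0)
  have hg := gq_bound α d h ρ hρ fun r _ => hh r
  set γ := ρ^2 * (∑ r ∈ Finset.Icc 1 d, |sibuya α r|) +
      (ρ * ∑ r ∈ Finset.Icc 1 d, |sibuya α r|)^2 with hγ
  obtain ⟨i1, -, -⟩ := EP_step hEP hα1 hθ phiE phiE_cont d hd h hz n hn
  have e : DD α μ K B d n h - 1 = (∫ ω, (phiE (K n ω) (XX α K B d h n ω) - 1) ∂μ) *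
      Complex.exp ((gq α d h / 2 : ℝ)) + (Complex.exp ((gq α d h / 2 : ℝ)) - 1) := by
    rw [integral_sub i1 (integrable_const 1), DD]
    simp
    ring
  rw [e]
  refine (norm_add_le _ _).trans (add_le_add ?_ ?_)
  · rw [norm_mul]
    gcongr
    · refine (norm_integral_le_of_norm_le_const (C := (ρ * ((∑ r ∈ Finset.Icc 1 d, (1 + |sibuya α r|)) * n)))
        ?_).trans (by simp)
      filter_upwards [EP_basic hEP n hn] with ω hω
      rw [phiE]
      refine Real.norm_exp_I_mul_ofReal_sub_one_le.trans ?_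
      have hk : (1:ℝ) ≤ K n ω := by exact_mod_cast hω.1
      have hkn : (K n ω : ℝ) ≤ n := by exact_mod_cast hω.2.1
      have hs : 1 ≤ √(K n ω : ℝ) := Real.one_le_sqrt.2 hk
      rw [Real.norm_eq_abs, abs_div, abs_of_nonneg (Real.sqrt_nonneg _)]
      refine (div_le_self (abs_nonneg _) hs).trans ((XX_bound d h n ω hω.2.2).trans ?_)
      rw [← mul_assoc, Finset.mul_sum]
      gcongr with r hr
      exact hh r
    · rw [Complex.norm_exp, Complex.ofReal_re]
      apply Real.exp_le_exp.2
      linarith [le_abs_self (gq α d h)]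
  · rw [← Complex.ofReal_exp, ← Complex.ofReal_one, ← Complex.ofReal_sub, Complex.norm_real,
      Real.norm_eq_abs, abs_le]
    have h1 := abs_le.1 hg
    have a1 := Real.add_one_le_exp (gq α d h / 2)
    have a2 := Real.add_one_le_exp (γ / 2)
    have a3 : Real.exp (gq α d h / 2) ≤ Real.exp (γ / 2) := Real.exp_le_exp.2 (by linarith)
    constructor <;> linarith

lemma DD_tendsto (hEP : IsEwensPitman α θ μ F K B) (hα0 : 0 < α) (hα1 : α < 1) (hθ : 0 < α + θ)
    (d : ℕ) (hd : 1 ≤ d) (h : ℕ → ℝ) (hz : ∀ r, r ∉ Finset.Icc 1 d → h r = 0) :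
    Tendsto (fun n => DD α μ K B d n h) atTop (𝓝 1) := by
  obtain ⟨R, hR⟩ : ∃ R, ∀ r, |h r| ≤ R := by
    refine ⟨∑ r ∈ Finset.Icc 1 d, |h r|, fun r => ?_⟩
    by_cases hr : r ∈ Finset.Icc 1 d
    · exact Finset.single_le_sum (f := fun r => |h r|) (fun _ _ => abs_nonneg _) hr
    · rw [hz r hr, abs_zero]; exact Finset.sum_nonneg fun _ _ => abs_nonneg _
  have hR0 : 0 ≤ R := (abs_nonneg _).trans (hR 0)
  obtain ⟨C, hC, H⟩ := iter_D hEP hα0 hα1 hθ d hd R hR0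
  rw [Metric.tendsto_atTop]
  intro ε hε
  have hS := sumEps hEP hα0 hα1 hθ d
  set u : ℕ → ℝ := fun n => epsE α μ K B d (n+1) * (((n+1 : ℕ):ℝ) + θ)⁻¹ with hu
  have hu0 : ∀ n, 0 ≤ u n := fun n => mul_nonneg
    (integral_nonneg fun ω => by positivity) (inv_pos.2 (n_theta_pos hα1 hθ (n+1) (by omega))).le
  have htail := tendsto_sum_nat_add u
  have h1 : ∀ᶠ N : ℕ in atTop, C * ∑' k, u (k + N) < ε / 2 := by
    have := htail.const_mul C
    rw [mul_zero] at this
    exact this.eventually (gt_mem_nhds (by positivity))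
  have h2 : ∀ᶠ N : ℕ in atTop, (d:ℝ) ≤ ((N+1:ℕ):ℝ) + θ := by
    have : Tendsto (fun N : ℕ => ((N+1:ℕ):ℝ) + θ) atTop atTop :=
      tendsto_atTop_add_const_right _ _ (tendsto_natCast_atTop_atTop.comp (tendsto_add_atTop_nat 1))
    exact this.eventually_ge_atTop _
  obtain ⟨N, hN1, hN2⟩ := (h1.and h2).exists
  have hp := prod_zero (n := N+1) hα0 hα1 hθ (by omega) d hd hN2
  set S1 := ∑ r ∈ Finset.Icc 1 d, (1 + |sibuya α r|)
  set S2 := ∑ r ∈ Finset.Icc 1 d, |sibuya α r|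
  have hcont : Continuous (fun ρ : ℝ => (ρ * (S1 * ((N+1:ℕ):ℝ))) *
      Real.exp ((ρ^2 * S2 + (ρ * S2)^2)/2) + (Real.exp ((ρ^2 * S2 + (ρ * S2)^2)/2) - 1)) := by
    fun_prop
  have hp' := hp.const_mul R
  rw [mul_zero] at hp'
  have ht := (hcont.tendsto 0).comp hp'
  have h3 : ∀ᶠ j in atTop, _ < ε / 2 := ht.eventually (gt_mem_nhds (by simp; positivity))
  obtain ⟨j0, hj0⟩ := eventually_atTop.1 h3
  refine ⟨N + 1 + j0, fun n hn => ?_⟩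
  obtain ⟨j, rfl⟩ : ∃ j, n = N + 1 + j := ⟨n - (N+1), by omega⟩
  obtain ⟨h', r1, r2, r3⟩ := H (N+1) (by omega) hN2 j h R le_rfl hR hz
  have b1 := DD_near hEP hα1 hθ d hd (N+1) (by omega) h' _ r1 (r2 _ (by simp))
  have b2 := hj0 j (by omega)
  simp only [Function.comp] at b2
  have b3 : C * ∑ i ∈ Finset.range j, (epsE α μ K B d (N+1+i) * (((N+1+i:ℕ):ℝ)+θ)⁻¹) < ε / 2 := by
    refine lt_of_le_of_lt (mul_le_mul_of_nonneg_left ?_ hC) hN1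
    have : ∀ i ∈ Finset.range j, (epsE α μ K B d (N+1+i) * (((N+1+i:ℕ):ℝ)+θ)⁻¹) = u (i + N) := by
      intro i _
      simp only [hu]
      rw [show N + 1 + i = i + N + 1 by ring]
    rw [Finset.sum_congr rfl this]
    exact ((summable_nat_add_iff N).2 hS).sum_le_tsum _ fun i _ => hu0 _
  rw [dist_eq_norm]
  calc _ = ‖(DD α μ K B d (N+1+j) h - DD α μ K B d (N+1) h') + (DD α μ K B d (N+1) h' - 1)‖ := by
        congr 1; ring
    _ ≤ _ := norm_add_le _ _
    _ < ε := by linarith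

lemma cf_tendsto (hEP : IsEwensPitman α θ μ F K B) (hα0 : 0 < α) (hα1 : α < 1) (hθ : 0 < α + θ)
    (d : ℕ) (hd : 1 ≤ d) (h : ℕ → ℝ) (hz : ∀ r, r ∉ Finset.Icc 1 d → h r = 0) :
    Tendsto (fun n => ∫ ω, phiE (K n ω) (XX α K B d h n ω) ∂μ) atTop
      (𝓝 (Complex.exp (-(gq α d h / 2 : ℝ)))) := by
  have := (DD_tendsto hEP hα0 hα1 hθ d hd h hz).mul_const (Complex.exp (-(gq α d h / 2 : ℝ)))
  rw [one_mul] at this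
  refine this.congr fun n => ?_
  rw [DD, mul_assoc, ← Complex.exp_add]
  simp
end EP

/-- Generalized binomial coefficient. -/
def cc (x : ℝ) : ℕ → ℝ
  | 0 => 1
  | n + 1 => cc x n * (x - n) / (n + 1)

lemma cc_zero (x : ℝ) : cc x 0 = 1 := rfl

lemma cc_succ (x : ℝ) (n : ℕ) : ((n:ℝ) + 1) * cc x (n+1) = (x - n) * cc x n := by
  have : ((n:ℝ) + 1) ≠ 0 := by positivity
  rw [cc]; field_simp

lemma cc_succ' (x : ℝ) (n : ℕ) : ((n:ℝ) + 1) * cc (x+1) (n+1) = (x + 1) * cc x n := by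
  induction n with
  | zero => simp [cc]
  | succ n ih =>
    have h1 := cc_succ (x+1) (n+1)
    have h2 := cc_succ x n
    have : ((n:ℝ) + 1) ≠ 0 := by positivity
    apply mul_left_cancel₀ this
    push_cast at h1 ⊢
    linear_combination ((n:ℝ)+1) * h1 + (x - n) * ih - (x+1) * h2

lemma cc_vander (r s : ℝ) (k : ℕ) :
    ∑ p ∈ Finset.HasAntidiagonal.antidiagonal k, cc r p.1 * cc s p.2 = cc (r + s) k := by
  induction k with
  | zero => simp [cc]
  | succ k ih =>
    have hk : ((k:ℝ) + 1) ≠ 0 := by positivity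
    apply mul_left_cancel₀ hk
    rw [cc_succ, ← ih]
    have e : ((k:ℝ)+1) * ∑ p ∈ Finset.HasAntidiagonal.antidiagonal (k+1), cc r p.1 * cc s p.2 =
        ∑ p ∈ Finset.HasAntidiagonal.antidiagonal (k+1), (p.1:ℝ) * (cc r p.1 * cc s p.2) +
        ∑ p ∈ Finset.HasAntidiagonal.antidiagonal (k+1), (p.2:ℝ) * (cc r p.1 * cc s p.2) := by
      rw [Finset.mul_sum, ← Finset.sum_add_distrib]
      refine Finset.sum_congr rfl fun p hp => ?_
      have : (p.1:ℝ) + p.2 = k + 1 := by exact_mod_cast Finset.HasAntidiagonal.mem_antidiagonal.1 hp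
      rw [← this]; ring
    rw [e, Finset.Nat.sum_antidiagonal_succ, Finset.Nat.sum_antidiagonal_succ' (n := k)
      (f := fun p : ℕ × ℕ => (p.2:ℝ) * (cc r p.1 * cc s p.2))]
    simp only [Nat.cast_zero, zero_mul, zero_add, add_zero]
    rw [← Finset.sum_add_distrib, Finset.mul_sum]
    refine Finset.sum_congr rfl fun p hp => ?_
    have : (p.1:ℝ) + p.2 = k := by exact_mod_cast Finset.HasAntidiagonal.mem_antidiagonal.1 hp
    have h1 := cc_succ r p.1
    have h2 := cc_succ s p.2
    rw [← this]
    push_cast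
    linear_combination cc s p.2 * h1 + cc r p.1 * h2

lemma cc_vander' (r s : ℝ) (k : ℕ) :
    ∑ i ∈ Finset.range (k+1), cc r i * cc s (k - i) = cc (r + s) k := by
  rw [← cc_vander, Finset.Nat.sum_antidiagonal_eq_sum_range_succ_mk]

lemma rising_cc (a : ℝ) (m : ℕ) :
    risingFactorial a m / (m.factorial : ℝ) = cc (a + m - 1) m := by
  induction m with
  | zero => simp [risingFactorial, cc]
  | succ m ih =>
    have h1 := cc_succ' (a + m - 1) m
    have : ((m:ℝ) + 1) ≠ 0 := by positivity
    have h2 : (m.factorial:ℝ) ≠ 0 := by positivity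
    have e : a + ((m+1:ℕ):ℝ) - 1 = a + m - 1 + 1 := by push_cast; ring
    rw [e]
    apply mul_left_cancel₀ this
    rw [h1, ← ih, risingFactorial, Nat.factorial_succ]
    push_cast
    field_simp
    ring

lemma rising_cc' (a : ℝ) (m : ℕ) :
    risingFactorial a m / (m.factorial : ℝ) = (-1)^m * cc (-a) m := by
  induction m with
  | zero => simp [risingFactorial, cc]
  | succ m ih =>
    have h1 := cc_succ (-a) m
    have : ((m:ℝ) + 1) ≠ 0 := by positivity
    have h2 : (m.factorial:ℝ) ≠ 0 := by positivity
    apply mul_left_cancel₀ this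
    rw [mul_left_comm, h1, risingFactorial, Nat.factorial_succ, pow_succ]
    have : (-1:ℝ)^m * -1 * ((-a - m) * cc (-a) m) = (a + m) * ((-1)^m * cc (-a) m) := by ring
    rw [this, ← ih]
    push_cast
    field_simp

lemma cc_nat (k j : ℕ) : cc (k:ℝ) j = (Nat.choose k j : ℝ) := by
  induction j with
  | zero => simp [cc]
  | succ j ih =>
    have : ((j:ℝ) + 1) ≠ 0 := by positivity
    apply mul_left_cancel₀ this
    rw [cc_succ, ih]
    rcases le_or_gt j k with h | h
    · have := Nat.choose_succ_right_eq k j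
      have h' : ((k - j : ℕ):ℝ) = (k:ℝ) - j := by rw [Nat.cast_sub h]
      rw [← h']
      have h2 : (Nat.choose k (j+1) : ℝ) * ((j:ℝ)+1) = Nat.choose k j * ((k - j : ℕ):ℝ) := by
        exact_mod_cast this
      linarith
    · rw [Nat.choose_eq_zero_of_lt h, Nat.choose_eq_zero_of_lt (by omega)]; simp

lemma jE_cc (α : ℝ) (j l : ℕ) (h : l ≤ j) : jEntry α j l = cc ((j:ℝ) - 1 - α) (j - l) := by
  rw [jEntry, if_pos h, rising_cc, Nat.cast_sub h]
  congr 1; ring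

lemma rising_shift (a : ℝ) (m : ℕ) :
    risingFactorial a (m+1) = a * risingFactorial (a+1) m := by
  induction m with
  | zero => simp [risingFactorial]
  | succ m ih =>
    rw [risingFactorial, ih, risingFactorial]; push_cast; ring

lemma jE_zero (α : ℝ) (j : ℕ) (h : 1 ≤ j) : cc ((j:ℝ) - 1 - α) j = - sibuya α j := by
  have := rising_cc (-α) j
  rw [show (j:ℝ) - 1 - α = -α + j - 1 by ring, ← this]
  obtain ⟨m, rfl⟩ : ∃ m, j = m + 1 := ⟨j - 1, by omega⟩
  rw [rising_shift, sibuya, Nat.add_sub_cancel, show -α + 1 = 1 - α by ring]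
  ring

lemma lam_cc (α : ℝ) (k l : ℕ) (hk : 1 ≤ k) :
    lambdaEntry α k l = (-1)^k * sibuya α k * cc (α - k) l := by
  induction l with
  | zero =>
    have : (k.factorial:ℝ) ≠ 0 := by positivity
    simp [lambdaEntry, cc]
    field_simp
    simp
  | succ l ih =>
    have h1 := cc_succ (α - k) l
    have : ((l:ℝ) + 1) ≠ 0 := by positivity
    apply mul_left_cancel₀ this
    rw [mul_left_comm, h1]
    have h2 := sibuya_succ α (k+l) (by omega)
    have h3 : (-1)^k * sibuya α k * ((α - k - l) * cc (α - k) l) =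
      (α - k - l) * lambdaEntry α k l := by rw [ih]; ring
    rw [h3]
    simp only [lambdaEntry]
    rw [← add_assoc, Nat.factorial_succ, Nat.factorial_succ]
    have f1 : (k.factorial:ℝ) ≠ 0 := by positivity
    have f2 : (l.factorial:ℝ) ≠ 0 := by positivity
    push_cast at h2 ⊢
    rw [pow_succ]
    field_simp
    linear_combination - h2

lemma sum_Icc_range (f : ℕ → ℝ) (j : ℕ) :
    ∑ l ∈ Finset.range (j+1), f l = f 0 + ∑ l ∈ Finset.Icc 1 j, f l := by
  induction j with
  | zero => simp
  | succ j ih => rw [Finset.sum_range_succ, ih, Finset.sum_Icc_succ_top (by omega)]; ring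

lemma inner_sumJ (α : ℝ) (k j : ℕ) (hk : 1 ≤ k) (hj : 1 ≤ j) :
    ∑ l ∈ Finset.Icc 1 j, lambdaEntry α k l * jEntry α j l =
      (-1)^k * sibuya α k * (sibuya α j + (-1)^j * (Nat.choose k j : ℝ)) := by
  have e : ∑ l ∈ Finset.Icc 1 j, lambdaEntry α k l * jEntry α j l =
      (-1)^k * sibuya α k * ∑ l ∈ Finset.Icc 1 j, cc (α - k) l * cc ((j:ℝ) - 1 - α) (j - l) := by
    rw [Finset.mul_sum]
    refine Finset.sum_congr rfl fun l hl => ?_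
    rw [lam_cc α k l hk, jE_cc α j l (Finset.mem_Icc.1 hl).2]; ring
  have v := cc_vander' (α - k) ((j:ℝ) - 1 - α) j
  rw [sum_Icc_range] at v
  simp only [cc_zero, Nat.sub_zero, one_mul] at v
  rw [jE_zero α j hj] at v
  have h1 := rising_cc (-(k:ℝ)) j
  rw [rising_cc', neg_neg, cc_nat] at h1
  rw [show α - k + ((j:ℝ) - 1 - α) = -(k:ℝ) + j - 1 by ring, ← h1] at v
  rw [e]
  congr 1
  linarith

lemma lam_flip (α : ℝ) (j k : ℕ) (h : j ≤ k) :
    lambdaEntry α j (k - j) = (-1)^k * sibuya α k * (Nat.choose k j : ℝ) := by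
  rw [lambdaEntry, Nat.add_sub_cancel' h, Nat.cast_choose ℝ h]; ring

lemma cc_alpha (α : ℝ) (l : ℕ) (hl : 1 ≤ l) : cc α l = - ((-1)^l * sibuya α l) := by
  have h := rising_cc' (-α) l
  rw [neg_neg, rising_cc, show -α + l - 1 = (l:ℝ) - 1 - α by ring, jE_zero α l hl] at h
  have : ((-1:ℝ)^l) * (-1)^l = 1 := by rw [← mul_pow]; simp
  linear_combination (- (-1)^l) * h - cc α l * this

lemma sumA1 (α : ℝ) (i : ℕ) (hi : 1 ≤ i) :
    ∑ k ∈ Finset.Icc 1 i, jEntry α i k * ((-1)^k * sibuya α k) = - sibuya α i := by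
  have v := cc_vander' α ((i:ℝ) - 1 - α) i
  rw [sum_Icc_range] at v
  simp only [cc_zero, Nat.sub_zero, one_mul] at v
  obtain ⟨m, rfl⟩ : ∃ m, i = m + 1 := ⟨i - 1, by omega⟩
  have h0 : cc (α + (((m+1:ℕ):ℝ) - 1 - α)) (m+1) = 0 := by
    rw [show α + (((m+1:ℕ):ℝ) - 1 - α) = (m:ℝ) by push_cast; ring, cc_nat]; simp
  rw [jE_zero α _ hi, h0] at v
  have e : ∑ l ∈ Finset.Icc 1 (m+1), cc α l * cc (((m+1:ℕ):ℝ) - 1 - α) (m + 1 - l) =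
      - ∑ k ∈ Finset.Icc 1 (m+1), jEntry α (m+1) k * ((-1)^k * sibuya α k) := by
    rw [← Finset.sum_neg_distrib]
    refine Finset.sum_congr rfl fun l hl => ?_
    rw [cc_alpha α l (Finset.mem_Icc.1 hl).1, jE_cc α _ l (Finset.mem_Icc.1 hl).2]; ring
  rw [e] at v
  linarith

lemma sumB1 (α : ℝ) (i j : ℕ) (hj : 1 ≤ j) :
    ∑ k ∈ Finset.Icc 1 i, jEntry α i k * ((-1)^k * sibuya α k * (Nat.choose k j : ℝ)) =
      if i = j then (-1)^j * sibuya α i else 0 := by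
  have e0 : ∑ k ∈ Finset.Icc 1 i, jEntry α i k * ((-1)^k * sibuya α k * (Nat.choose k j : ℝ)) =
      ∑ k ∈ Finset.Icc j i, jEntry α i k * ((-1)^k * sibuya α k * (Nat.choose k j : ℝ)) := by
    symm
    apply Finset.sum_subset (Finset.Icc_subset_Icc_left hj)
    intro k hk hk'
    rw [Nat.choose_eq_zero_of_lt]; simp
    simp at hk hk'
    by_contra hc
    have := hk' (by omega)
    omega
  rw [e0]
  rcases lt_or_ge i j with h | h
  · rw [Finset.Icc_eq_empty (by omega), if_neg (by omega)]; simp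
  obtain ⟨m, rfl⟩ : ∃ m, i = j + m := ⟨i - j, by omega⟩
  have e1 : ∑ k ∈ Finset.Icc j (j+m), jEntry α (j+m) k * ((-1)^k * sibuya α k * (Nat.choose k j : ℝ)) =
      ∑ l ∈ Finset.range (m+1), ((-1)^j * sibuya α j) * (cc (α - j) l * cc (((j+m:ℕ):ℝ) - 1 - α) (m - l)) := by
    rw [show Finset.Icc j (j+m) = Finset.Ico j (j + (m+1)) by ext; simp; omega,
      Finset.sum_Ico_eq_sum_range]
    simp only [Nat.add_sub_cancel_left]
    refine Finset.sum_congr rfl fun l hl => ?_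
    have hl' := Finset.mem_range.1 hl
    rw [← lam_flip α j (j+l) (by omega), Nat.add_sub_cancel_left, lam_cc α j l hj,
      jE_cc α (j+m) (j+l) (by omega), show j + m - (j + l) = m - l by omega]
    ring
  rw [e1, ← Finset.mul_sum, cc_vander']
  rcases Nat.eq_zero_or_pos m with rfl | hm
  · simp [cc]
  · rw [if_neg (by omega)]
    obtain ⟨q, rfl⟩ : ∃ q, m = q + 1 := ⟨m - 1, by omega⟩
    rw [show α - j + (((j+(q+1):ℕ):ℝ) - 1 - α) = (q:ℝ) by push_cast; ring, cc_nat]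
    simp

lemma gamma_eq (α : ℝ) (i j : ℕ) (hi : 1 ≤ i) (hj : 1 ≤ j) :
    gammaEntry α i j = (if i = j then sibuya α i else 0) - sibuya α i * sibuya α j := by
  unfold gammaEntry
  have e : ∀ k ∈ Finset.Icc 1 i, ∑ l ∈ Finset.Icc 1 j,
      jEntry α i k * lambdaEntry α k l * jEntry α j l =
      sibuya α j * (jEntry α i k * ((-1)^k * sibuya α k)) +
      (-1)^j * (jEntry α i k * ((-1)^k * sibuya α k * (Nat.choose k j : ℝ))) := by
    intro k hk
    have := inner_sumJ α k j (Finset.mem_Icc.1 hk).1 hj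
    simp only [mul_assoc]
    rw [← Finset.mul_sum, this]; ring
  rw [Finset.sum_congr rfl e, Finset.sum_add_distrib, ← Finset.mul_sum, ← Finset.mul_sum,
    sumA1 α i hi, sumB1 α i j hj]
  split_ifs with h
  · have : ((-1:ℝ)^j) * (-1)^j = 1 := by rw [← mul_pow]; simp
    linear_combination (sibuya α i) * this
  · ring

lemma sib_sum (α : ℝ) (d : ℕ) :
    1 - ∑ r ∈ Finset.Icc 1 d, sibuya α r = risingFactorial (1 - α) d / (d.factorial : ℝ) := by
  induction d with
  | zero => simp [risingFactorial]
  | succ d ih =>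
    rw [Finset.sum_Icc_succ_top (by omega), ← sub_sub, ih, sibuya, Nat.add_sub_cancel,
      risingFactorial, Nat.factorial_succ]
    have : (d.factorial:ℝ) ≠ 0 := by positivity
    push_cast
    field_simp
    ring

lemma rising_nonneg (a : ℝ) (ha : 0 ≤ a) (m : ℕ) : 0 ≤ risingFactorial a m := by
  induction m with
  | zero => simp [risingFactorial]
  | succ m ih => rw [risingFactorial]; positivity

lemma gq_nonneg (α : ℝ) (hα0 : 0 < α) (hα1 : α < 1) (d : ℕ) (h : ℕ → ℝ) : 0 ≤ gq α d h := by
  unfold gq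
  have h1 : ∑ r ∈ Finset.Icc 1 d, sibuya α r ≤ 1 := by
    have := sib_sum α d
    have h2 := div_nonneg (rising_nonneg (1-α) (by linarith) d) (Nat.cast_nonneg d.factorial)
    linarith
  have hp : ∀ r ∈ Finset.Icc 1 d, 0 ≤ sibuya α r := fun r hr =>
    (sibuya_pos α hα0 hα1 r (Finset.mem_Icc.1 hr).1).le
  have cs := Finset.sum_sq_le_sum_mul_sum_of_sq_eq_mul (Finset.Icc 1 d)
    (r := fun r => h r * sibuya α r) (f := fun r => sibuya α r) (g := fun r => sibuya α r * h r^2)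
    hp (fun r hr => mul_nonneg (hp r hr) (sq_nonneg _)) (fun r _ => by ring)
  have h3 : 0 ≤ ∑ r ∈ Finset.Icc 1 d, sibuya α r * h r^2 :=
    Finset.sum_nonneg fun r hr => mul_nonneg (hp r hr) (sq_nonneg _)
  have := mul_le_mul_of_nonneg_right h1 h3
  linarith

/-- Extension of a vector by zero to a function on the naturals (shifted by one). -/
def hext {d : ℕ} (a : Fin d → ℝ) (r : ℕ) : ℝ :=
  if h : 1 ≤ r ∧ r - 1 < d then a ⟨r - 1, h.2⟩ else 0

lemma hext_fin {d : ℕ} (a : Fin d → ℝ) (i : Fin d) : hext a (i.val + 1) = a i := by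
  simp [hext]

lemma hext_out {d : ℕ} (a : Fin d → ℝ) (r : ℕ) (hr : r ∉ Finset.Icc 1 d) : hext a r = 0 := by
  rw [hext, dif_neg]
  simp at hr
  omega

lemma sum_Icc_fin (d : ℕ) (f : ℕ → ℝ) :
    ∑ r ∈ Finset.Icc 1 d, f r = ∑ i : Fin d, f (i.val + 1) := by
  rw [← Finset.sum_range (fun i => f (i+1)), Finset.range_eq_Ico,
    Finset.sum_Ico_add' f 0 d 1]
  rfl

lemma quad_eq (α : ℝ) (d : ℕ) (a : Fin d → ℝ) :
    ∑ i, ∑ j, a i * gammaEntry α (i.val + 1) (j.val + 1) * a j = gq α d (hext a) := by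
  unfold gq
  rw [sum_Icc_fin, sum_Icc_fin, sq, Finset.sum_mul_sum, ← Finset.sum_sub_distrib]
  refine Finset.sum_congr rfl fun i _ => ?_
  have e : ∀ j : Fin d, a i * gammaEntry α (i.val + 1) (j.val + 1) * a j =
      (if i = j then a i * sibuya α (i.val+1) * a j else 0) -
      hext a (i.val+1) * sibuya α (i.val+1) * (hext a (j.val+1) * sibuya α (j.val+1)) := by
    intro j
    rw [gamma_eq _ _ _ (by omega) (by omega), hext_fin, hext_fin]
    by_cases h : i = j
    · subst h; simp; ring
    · have : ¬ (i.val + 1 = j.val + 1) := fun h' => h (Fin.ext (by omega))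
      rw [if_neg h, if_neg this]; ring
  rw [Finset.sum_congr rfl fun j _ => e j, Finset.sum_sub_distrib, Finset.sum_ite_eq]
  simp [hext_fin]
  ring

/-- The limit covariance matrix. -/
def SS (α : ℝ) (d : ℕ) : Matrix (Fin d) (Fin d) ℝ :=
  Matrix.of fun i j => gammaEntry α (i.val + 1) (j.val + 1)

lemma SS_quad (α : ℝ) (d : ℕ) (a : Fin d → ℝ) :
    a ⬝ᵥ ((SS α d).mulVec a) = gq α d (hext a) := by
  rw [← quad_eq]
  simp only [dotProduct, Matrix.mulVec, SS, Matrix.of_apply, Finset.mul_sum, mul_assoc]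

lemma SS_psd (α : ℝ) (hα0 : 0 < α) (hα1 : α < 1) (d : ℕ) : (SS α d).PosSemidef := by
  refine Matrix.PosSemidef.of_dotProduct_mulVec_nonneg ?_ ?_
  · ext i j
    simp only [Matrix.conjTranspose_apply, SS, Matrix.of_apply, star_trivial]
    rw [gamma_eq _ _ _ (by omega) (by omega), gamma_eq _ _ _ (by omega) (by omega)]
    by_cases h : i = j
    · subst h; rfl
    · have h1 : ¬ (i.val + 1 = j.val + 1) := fun h' => h (Fin.ext (by omega))
      have h2 : ¬ (j.val + 1 = i.val + 1) := fun h' => h (Fin.ext (by omega))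
      rw [if_neg h1, if_neg h2]; ring
  · intro x
    rw [star_trivial, SS_quad]
    exact gq_nonneg α hα0 hα1 d _

/-- The Gaussian limit on Euclidean space. -/
def GG (α : ℝ) (d : ℕ) : Measure (EuclideanSpace ℝ (Fin d)) := multivariateGaussian 0 (SS α d)

instance GG_prob (α : ℝ) (d : ℕ) : IsProbabilityMeasure (GG α d) := by
  unfold GG; infer_instance

lemma GG_charFun (α : ℝ) (hα0 : 0 < α) (hα1 : α < 1) (d : ℕ) (t : EuclideanSpace ℝ (Fin d)) :
    charFun (GG α d) t = Complex.exp (-(gq α d (hext t.ofLp) / 2 : ℝ)) := by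
  rw [GG, charFun_multivariateGaussian (SS_psd α hα0 hα1 d), SS_quad]
  simp

lemma inner_sumE {d : ℕ} (x t : EuclideanSpace ℝ (Fin d)) :
    inner ℝ x t = ∑ i, t.ofLp i * x.ofLp i := by
  simp [PiLp.inner_apply]

lemma GG_marg (α : ℝ) (hα0 : 0 < α) (hα1 : α < 1) (d : ℕ) (a : Fin d → ℝ) :
    ((GG α d).map WithLp.ofLp).map (fun x : Fin d → ℝ => ∑ i, a i * x i) =
      gaussianReal 0 (Real.toNNReal
        (∑ i, ∑ j, a i * gammaEntry α (i.val + 1) (j.val + 1) * a j)) := by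
  have m1 : Measurable (WithLp.ofLp : EuclideanSpace ℝ (Fin d) → Fin d → ℝ) := by fun_prop
  have m2 : Measurable (fun x : Fin d → ℝ => ∑ i, a i * x i) := by fun_prop
  rw [Measure.map_map m2 m1]
  have : IsProbabilityMeasure ((GG α d).map
    ((fun x : Fin d → ℝ => ∑ i, a i * x i) ∘ WithLp.ofLp)) :=
    Measure.isProbabilityMeasure_map (m2.comp m1).aemeasurable
  apply Measure.ext_of_charFun
  funext s
  have h1 : charFun ((GG α d).map ((fun x : Fin d → ℝ => ∑ i, a i * x i) ∘ WithLp.ofLp)) s =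
      charFun (GG α d) (WithLp.toLp 2 (fun i => s * a i)) := by
    rw [charFun_apply_real, charFun_apply, integral_map (m2.comp m1).aemeasurable (by fun_prop)]
    refine integral_congr_ae (ae_of_all _ fun x => ?_)
    simp only [inner_sumE, Function.comp]
    congr 2
    rw [← Complex.ofReal_mul, Finset.mul_sum]
    congr 1
    refine Finset.sum_congr rfl fun i _ => by ring
  rw [h1, GG_charFun α hα0 hα1, charFun_gaussianReal, quad_eq,
    Real.coe_toNNReal _ (gq_nonneg α hα0 hα1 d _)]
  have h2 : gq α d (hext fun i => s * a i) = s^2 * gq α d (hext a) := by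
    rw [← quad_eq, ← quad_eq, Finset.mul_sum]
    refine Finset.sum_congr rfl fun i _ => ?_
    rw [Finset.mul_sum]
    refine Finset.sum_congr rfl fun j _ => by ring
  simp only [h2]
  push_cast
  ring_nf

/-- Multi-dimensional CLT for the self-normalized process: the vector
`(√(K_n)(P_{1,n} - p_α(1)), …, √(K_n)(P_{d,n} - p_α(d)))` converges in distribution to a
centered `d`-dimensional Gaussian with covariance matrix `Γ_d = J_d Λ_d J_dᵀ`
(characterized by the fact that each linear functional `x ↦ ∑ᵢ aᵢ xᵢ` is a centered real
Gaussian with variance `aᵀ Γ_d a`). -/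
theorem multidim_clt_selfnormalized (α θ : ℝ) (hα0 : 0 < α) (hα1 : α < 1)
    (hθ : 0 < α + θ)
    {Ω : Type*} [mΩ : MeasurableSpace Ω] (μ : Measure Ω) (F : Filtration ℕ mΩ)
    (K : ℕ → Ω → ℕ) (B : ℕ → ℕ → Ω → ℕ) (hEP : IsEwensPitman α θ μ F K B)
    (d : ℕ) (hd : 1 ≤ d) :
    ∃ ν : Measure (Fin d → ℝ), IsProbabilityMeasure ν ∧
      (∀ a : Fin d → ℝ,
        ν.map (fun x => ∑ i, a i * x i) =
          gaussianReal 0 (Real.toNNReal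
            (∑ i, ∑ j, a i * gammaEntry α (i.val + 1) (j.val + 1) * a j))) ∧
      ∀ f : BoundedContinuousFunction (Fin d → ℝ) ℝ,
        Tendsto
          (fun n => ∫ ω, f (fun r : Fin d => Real.sqrt (K n ω : ℝ) *
            ((B (r.val + 1) n ω : ℝ) / (K n ω : ℝ) - sibuya α (r.val + 1))) ∂μ)
          atTop
          (𝓝 (∫ x, f x ∂ν)) := by
  have hP : IsProbabilityMeasure μ := hEP.prob
  have m1 : Measurable (WithLp.ofLp : EuclideanSpace ℝ (Fin d) → Fin d → ℝ) := by fun_prop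
  refine ⟨(GG α d).map WithLp.ofLp, Measure.isProbabilityMeasure_map m1.aemeasurable,
    GG_marg α hα0 hα1 d, ?_⟩
  intro f
  set V : ℕ → Ω → Fin d → ℝ := fun n ω r => Real.sqrt (K n ω : ℝ) *
            ((B (r.val + 1) n ω : ℝ) / (K n ω : ℝ) - sibuya α (r.val + 1)) with hV
  have mV : ∀ n, Measurable (V n) := by
    intro n
    refine measurable_pi_lambda _ fun r => ?_
    have hk : Measurable fun ω => (K n ω : ℝ) := measurable_from_top.comp (EP_measK hEP n)
    have hb : Measurable fun ω => (B (r.val+1) n ω : ℝ) :=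
      measurable_from_top.comp (EP_measB hEP (r.val+1) n)
    exact hk.sqrt.mul ((hb.div hk).sub_const _)
  have mT : Measurable (WithLp.toLp 2 : (Fin d → ℝ) → EuclideanSpace ℝ (Fin d)) := by fun_prop
  have mE : ∀ n, Measurable (fun ω => (WithLp.toLp 2 (V n ω) : EuclideanSpace ℝ (Fin d))) :=
    fun n => mT.comp (mV n)
  let M : ℕ → ProbabilityMeasure (EuclideanSpace ℝ (Fin d)) := fun n =>
    ⟨μ.map (fun ω => WithLp.toLp 2 (V n ω)), Measure.isProbabilityMeasure_map (mE n).aemeasurable⟩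
  let M0 : ProbabilityMeasure (EuclideanSpace ℝ (Fin d)) := ⟨GG α d, GG_prob α d⟩
  have hM : Tendsto M atTop (𝓝 M0) := by
    rw [ProbabilityMeasure.tendsto_iff_tendsto_charFun]
    intro t
    change Tendsto (fun n => charFun (μ.map (fun ω => WithLp.toLp 2 (V n ω))) t) atTop
      (𝓝 (charFun (GG α d) t))
    rw [GG_charFun α hα0 hα1]
    refine (cf_tendsto hEP hα0 hα1 hθ d hd (hext t.ofLp) (hext_out _)).congr' ?_
    filter_upwards [eventually_ge_atTop 1] with n hn
    rw [charFun_apply, integral_map (mE n).aemeasurable (by fun_prop)]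
    refine integral_congr_ae ?_
    filter_upwards [EP_basic hEP n hn] with ω hω
    rw [phiE, mul_comm, inner_sumE, XX, sum_Icc_fin, Finset.sum_div]
    congr 3
    refine Finset.sum_congr rfl fun i _ => ?_
    rw [hext_fin]
    have hk : (0:ℝ) < K n ω := by exact_mod_cast hω.1
    have hs : √(K n ω : ℝ) ≠ 0 := (Real.sqrt_pos.2 hk).ne'
    have hsq : √(K n ω : ℝ) * √(K n ω : ℝ) = K n ω := Real.mul_self_sqrt hk.le
    rw [mul_div_assoc]
    congr 1
    simp only [hV]
    rw [div_eq_iff hs]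
    have e : (B (i.val+1) n ω : ℝ) - sibuya α (i.val+1) * K n ω =
      K n ω * ((B (i.val+1) n ω : ℝ) / K n ω - sibuya α (i.val+1)) := by
      field_simp
    rw [e, ← hsq]
    simp only [hsq]
    linear_combination (-((B (i.val+1) n ω : ℝ) / K n ω - sibuya α (i.val+1))) * hsq
  have cO : Continuous (WithLp.ofLp : EuclideanSpace ℝ (Fin d) → Fin d → ℝ) := by fun_prop
  have h := (ProbabilityMeasure.tendsto_iff_forall_integral_tendsto.1 hM)
    (f.compContinuous ⟨WithLp.ofLp, cO⟩)
  have e0 : ∫ x, f x ∂((GG α d).map WithLp.ofLp) =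
      ∫ x, (f.compContinuous ⟨WithLp.ofLp, cO⟩) x ∂(M0 : Measure (EuclideanSpace ℝ (Fin d))) := by
    rw [integral_map m1.aemeasurable f.continuous.aestronglyMeasurable]
    rfl
  rw [e0]
  refine h.congr fun n => ?_
  change ∫ x, (f.compContinuous ⟨WithLp.ofLp, cO⟩) x ∂(μ.map (fun ω => WithLp.toLp 2 (V n ω))) = _
  rw [integral_map (mE n).aemeasurable
    (f.compContinuous ⟨WithLp.ofLp, cO⟩).continuous.aestronglyMeasurable]
  rfl

end
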